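/- arXiv:2306.15402 — 9 statements merged into one kernel-verified Lean document; each statement's English description precedes it below -/
import Mathlib

section
/- Let C be a doubly even self-dual binary linear code of length N. Then the code-lattice L(C) is even and self-dual: (1) for every c ∈ L(C), the norm ⟨c, c⟩ = 2·∑ᵢ (c i)² lies in 2ℤ (equivalently ∑ᵢ (c i)² ∈ ℤ); and (2) for every x : Fin N → ℚ, x ∈ L(C) if and only if ⟨x, c⟩ = 2·∑ᵢ (x i)·(c i) ∈ ℤ for all c ∈ L(C). -/
/-- The code-lattice `L(C)` of a binary linear code `C ⊆ 𝔽₂^N` (Tasaka's version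
of Construction A written in an orthogonal basis of norm-2 vectors): rational
vectors `c` with `2 c i ∈ ℤ` whose mod-2 reduction `i ↦ (2 c i mod 2)` lies in
`C`.  The ambient bilinear form is `⟨x, y⟩ = 2 * ∑ i, x i * y i`. -/
def codeLattice {N : ℕ} (C : Submodule (ZMod 2) (Fin N → ZMod 2)) :
    Set (Fin N → ℚ) :=
  {c | ∃ a : Fin N → ℤ, (∀ i, 2 * c i = (a i : ℚ)) ∧ (fun i => (a i : ZMod 2)) ∈ C}

theorem Int.four_dvd_sq_sub_ite (n : ℤ) :
    (4 : ℤ) ∣ n * n - if (n : ZMod 2) ≠ 0 then 1 else 0 := by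
  rcases Int.even_or_odd' n with ⟨k, rfl | rfl⟩
  · have h : ((2 * k : ℤ) : ZMod 2) = 0 :=
      (ZMod.intCast_zmod_eq_zero_iff_dvd _ 2).2 ⟨k, rfl⟩
    rw [if_neg (not_not.2 h)]
    exact ⟨k * k, by ring⟩
  · have h : ((2 * k + 1 : ℤ) : ZMod 2) ≠ 0 := by
      rw [Ne, ZMod.intCast_zmod_eq_zero_iff_dvd]
      push_cast
      omega
    rw [if_pos h]
    exact ⟨k * k + k, by ring⟩

/-- The sum of squares of an integer vector is congruent mod 4 to the weight of its reduction
mod 2. -/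
theorem four_dvd_sum_sq {ι : Type*} [Fintype ι] (a : ι → ℤ)
    (h : 4 ∣ (Finset.filter (fun i => (a i : ZMod 2) ≠ 0) Finset.univ).card) :
    (4 : ℤ) ∣ ∑ i, a i * a i := by
  have hsub : (4 : ℤ) ∣ ∑ i, (a i * a i - if (a i : ZMod 2) ≠ 0 then 1 else 0) :=
    Finset.dvd_sum fun i _ => Int.four_dvd_sq_sub_ite (a i)
  rw [Finset.sum_sub_distrib, Finset.sum_boole] at hsub
  exact (dvd_sub_left (by exact_mod_cast h)).1 hsub

theorem two_mul_sum_mul_eq {ι : Type*} [Fintype ι] {x y : ι → ℚ} {a b : ι → ℤ}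
    (ha : ∀ i, 2 * x i = a i) (hb : ∀ i, 2 * y i = b i) :
    2 * (2 * ∑ i, x i * y i) = ((∑ i, a i * b i : ℤ) : ℚ) := by
  push_cast
  rw [Finset.mul_sum, Finset.mul_sum]
  refine Finset.sum_congr rfl fun i _ => ?_
  rw [← ha i, ← hb i]
  ring

theorem single_one_mem_codeLattice {N : ℕ} (C : Submodule (ZMod 2) (Fin N → ZMod 2))
    (i : Fin N) : (Pi.single i 1 : Fin N → ℚ) ∈ codeLattice C := by
  refine ⟨Pi.single i 2, fun j => ?_, ?_⟩
  · by_cases hj : j = i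
    · subst hj; simp
    · simp [hj]
  · convert C.zero_mem using 1
    funext j
    by_cases hj : j = i
    · subst hj
      simpa using (show (2 : ZMod 2) = 0 from rfl)
    · simp [hj]

/-- If `C` is a doubly even self-dual binary linear code of length `N`, then the
code-lattice `L(C)` is even (`⟨c, c⟩ ∈ 2ℤ` for all `c ∈ L(C)`) and self-dual
(`x ∈ L(C)` iff `⟨x, c⟩ ∈ ℤ` for all `c ∈ L(C)`). -/
theorem stmt_2 {N : ℕ} (C : Submodule (ZMod 2) (Fin N → ZMod 2))
    (hDE : ∀ v ∈ C, 4 ∣ (Finset.filter (fun i => v i ≠ 0) Finset.univ).card)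
    (hSD : ∀ x : Fin N → ZMod 2, x ∈ C ↔ ∀ c ∈ C, ∑ i, x i * c i = 0) :
    (∀ c ∈ codeLattice C, ∃ m : ℤ, (2 * ∑ i, c i * c i : ℚ) = 2 * (m : ℚ)) ∧
    (∀ x : Fin N → ℚ, x ∈ codeLattice C ↔
      ∀ c ∈ codeLattice C, ∃ m : ℤ, (2 * ∑ i, x i * c i : ℚ) = (m : ℚ)) := by
  refine ⟨?_, fun x => ⟨?_, fun hx => ?_⟩⟩
  · rintro c ⟨a, ha, haC⟩
    obtain ⟨m, hm⟩ := four_dvd_sum_sq a (hDE _ haC)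
    have h := two_mul_sum_mul_eq ha ha
    rw [hm] at h
    push_cast at h
    exact ⟨m, by linarith⟩
  · rintro ⟨a, ha, haC⟩ c ⟨b, hb, hbC⟩
    obtain ⟨m, hm⟩ : (2 : ℤ) ∣ ∑ i, a i * b i := by
      refine (ZMod.intCast_zmod_eq_zero_iff_dvd _ 2).1 ?_
      push_cast
      exact (hSD _).1 haC _ hbC
    have h := two_mul_sum_mul_eq ha hb
    rw [hm] at h
    push_cast at h
    exact ⟨m, by linarith⟩
  · have hint : ∀ i, ∃ m : ℤ, 2 * x i = (m : ℚ) := fun i => by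
      simpa [Pi.single_apply] using hx _ (single_one_mem_codeLattice C i)
    choose a ha using hint
    refine ⟨a, ha, (hSD _).2 fun v hv => ?_⟩
    have hlift : (fun i => (((v i).val : ℤ) : ZMod 2)) = v := by
      funext i
      simp
    have hb : ∀ i, 2 * (((v i).val : ℚ) / 2) = (((v i).val : ℤ) : ℚ) := fun i => by
      push_cast
      ring
    obtain ⟨m, hm⟩ := hx (fun i => ((v i).val : ℚ) / 2)
      ⟨fun i => (v i).val, hb, by rwa [hlift]⟩
    have h := two_mul_sum_mul_eq ha hb
    rw [hm] at h
    have hdvd : (2 : ℤ) ∣ ∑ i, a i * ((v i).val : ℤ) := ⟨m, by exact_mod_cast h.symm⟩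
    have hzero := (ZMod.intCast_zmod_eq_zero_iff_dvd _ 2).2 hdvd
    simpa using hzero
end

section
/- Let C be a doubly even self-dual binary linear code of length N, let r divide N, and let σ be an automorphism of C of cycle type r^{N/r}, i.e., every orbit of ⟨σ⟩ on Fin N has cardinality r. Suppose the fixed subcode C^σ = {v ∈ C | v ∘ σ = v} has 𝔽₂-dimension N/(2r) and is spanned by codewords B₁, …, B_{N/(2r)} whose supports are pairwise disjoint, cover all of Fin N, and each have cardinality 2r. Then the theta series of the fixed sublattice L(C)^σ equals ϑ₃(q^r)^{N/r}, the theta series of the lattice A₁(r)^{N/r}; concretely, for every k ∈ ℚ, the (finite) number of c ∈ L(C) with c(σ(i)) = c(i) for all i and ∑ᵢ (c i)² = k equals the number of n : Fin (N/r) → ℤ with r · ∑ⱼ (n j)² = 2k. -/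
/-- The subcode of `C` fixed by a permutation `σ` of the coordinates. -/
def fixedSubcode {N : ℕ} (C : Submodule (ZMod 2) (Fin N → ZMod 2))
    (σ : Equiv.Perm (Fin N)) : Submodule (ZMod 2) (Fin N → ZMod 2) where
  carrier := {v | v ∈ C ∧ ∀ i, v (σ i) = v i}
  add_mem' := fun ha hb => ⟨C.add_mem ha.1 hb.1, fun i => by
    simp [Pi.add_apply, ha.2 i, hb.2 i]⟩
  zero_mem' := ⟨C.zero_mem, fun _ => rfl⟩
  smul_mem' := fun c v hv => ⟨C.smul_mem c hv.1, fun i => by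
    simp [Pi.smul_apply, hv.2 i]⟩

/-- A function invariant under `σ` is constant on the orbits of `⟨σ⟩`. -/
theorem eq_of_mem_orbit_zpowers {α β : Type*} {σ : Equiv.Perm α} {f : α → β}
    (hf : ∀ i, f (σ i) = f i) {i p : α}
    (h : i ∈ MulAction.orbit (Subgroup.zpowers σ) p) : f i = f p := by
  obtain ⟨⟨g, z, rfl⟩, rfl⟩ := h
  change f ((σ ^ z) p) = f p
  induction z using Int.induction_on with
  | zero => simp
  | succ n ih => rw [add_comm, zpow_add, zpow_one, Equiv.Perm.mul_apply, hf, ih]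
  | pred n ih =>
    rw [← ih, ← hf, ← Equiv.Perm.mul_apply, ← zpow_one_add]
    congr 3
    ring

/-- A `σ`-stable set of cardinality `2 * r` is the union of two orbits of cardinality `r`. -/
theorem exists_orbit_pair {N r : ℕ} (hr : 0 < r) (σ : Equiv.Perm (Fin N))
    (hCyc : ∀ i : Fin N, Nat.card (MulAction.orbit (Subgroup.zpowers σ) i) = r)
    (S : Set (Fin N)) (hS : ∀ i, (σ i ∈ S) = (i ∈ S)) (hcard : Nat.card S = 2 * r) :
    ∃ p q : Fin N, p ∈ S ∧ q ∈ S ∧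
      Disjoint (MulAction.orbit (Subgroup.zpowers σ) p) (MulAction.orbit (Subgroup.zpowers σ) q) ∧
      S = MulAction.orbit (Subgroup.zpowers σ) p ∪ MulAction.orbit (Subgroup.zpowers σ) q := by
  have hsub : ∀ p ∈ S, MulAction.orbit (Subgroup.zpowers σ) p ⊆ S := fun p hp i hi => by
    have := eq_of_mem_orbit_zpowers (f := fun i => i ∈ S) hS hi
    exact this ▸ hp
  have hcyc : ∀ i, (MulAction.orbit (Subgroup.zpowers σ) i).ncard = r := hCyc
  have hcard' : S.ncard = 2 * r := hcard
  obtain ⟨p, hp⟩ : S.Nonempty := by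
    rw [← Set.ncard_pos]; omega
  obtain ⟨q, hq, hqp⟩ : ∃ q ∈ S, q ∉ MulAction.orbit (Subgroup.zpowers σ) p := by
    refine Set.exists_mem_notMem_of_ncard_lt_ncard ?_ (Set.toFinite _)
    rw [hcyc, hcard']; omega
  have hd : Disjoint (MulAction.orbit (Subgroup.zpowers σ) p)
      (MulAction.orbit (Subgroup.zpowers σ) q) := by
    rw [Set.disjoint_left]
    intro i hip hiq
    apply hqp
    rw [← MulAction.orbit_eq_iff] at hip hiq ⊢
    rw [← hiq, hip]
  refine ⟨p, q, hp, hq, hd, (Set.eq_of_subset_of_ncard_le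
    (Set.union_subset (hsub p hp) (hsub q hq)) ?_).symm⟩
  rw [Set.ncard_union_eq hd, hcyc, hcyc, hcard']; omega

/-- Counting integer vectors of given norm in dimension `M + M`, as pairs of vectors. -/
theorem card_sum_sq_eq_pairs {n M : ℕ} (h : n = M + M) (r k : ℚ) :
    Nat.card {x : Fin n → ℤ // r * ∑ j, (x j : ℚ) ^ 2 = k} =
      Nat.card {x : (Fin M → ℤ) × (Fin M → ℤ) //
        r * ∑ j, ((x.1 j : ℚ) ^ 2 + (x.2 j : ℚ) ^ 2) = k} := by
  subst h
  refine Nat.card_congr (Equiv.subtypeEquiv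
    ((Equiv.arrowCongr finSumFinEquiv.symm (Equiv.refl ℤ)).trans
      (Equiv.sumArrowEquivProdArrow _ _ _)) fun x => ?_)
  simp [Fin.sum_univ_add, Finset.sum_add_distrib, Equiv.sumArrowEquivProdArrow]

/-- Theorem B of the paper: let `C` be a doubly even self-dual binary linear
code of length `N`, `r ∣ N`, and `σ ∈ Aut C` of cycle type `r^{N/r}`.  If the
fixed subcode `C^σ` has dimension `N/(2r)` and is spanned by codewords with
pairwise disjoint supports of cardinality `2r` covering `Fin N`, then the theta
series of the fixed sublattice `L(C)^σ` equals `ϑ₃(q^r)^{N/r}`, the theta series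
of `A₁(r)^{N/r}`: for each `k ∈ ℚ` the number of `c ∈ L(C)^σ` of norm
`∑ᵢ (c i)² = k` equals the number of `n : Fin (N/r) → ℤ` with
`r · ∑ⱼ (n j)² = 2k`. -/
theorem stmt_3 {N r : ℕ} (hrN : r ∣ N)
    (C : Submodule (ZMod 2) (Fin N → ZMod 2))
    (hDE : ∀ v ∈ C, 4 ∣ (Finset.filter (fun i => v i ≠ 0) Finset.univ).card)
    (hSD : ∀ x : Fin N → ZMod 2, x ∈ C ↔ ∀ c ∈ C, ∑ i, x i * c i = 0)
    (σ : Equiv.Perm (Fin N))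
    (hAut : ∀ v ∈ C, (fun i => v (σ⁻¹ i)) ∈ C)
    (hCyc : ∀ i : Fin N, Nat.card (MulAction.orbit (Subgroup.zpowers σ) i) = r)
    (hdim : Module.finrank (ZMod 2) (fixedSubcode C σ) = N / (2 * r))
    (B : Fin (N / (2 * r)) → (Fin N → ZMod 2))
    (hBmem : ∀ j, B j ∈ fixedSubcode C σ)
    (hspan : Submodule.span (ZMod 2) (Set.range B) = fixedSubcode C σ)
    (hdisj : ∀ j k, j ≠ k → {i | B j i = 1} ∩ {i | B k i = 1} = ∅)
    (hcover : (⋃ j, {i | B j i = 1}) = Set.univ)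
    (hcard : ∀ j, Nat.card {i | B j i = 1} = 2 * r) :
    ∀ k : ℚ,
      Nat.card {c : Fin N → ℚ //
        c ∈ codeLattice C ∧ (∀ i, c (σ i) = c i) ∧ ∑ i, c i * c i = k}
      = Nat.card {n : Fin (N / r) → ℤ // (r : ℚ) * ∑ j, (n j : ℚ) ^ 2 = 2 * k} := by
  classical
  have hr : ∀ _ : Fin (N / (2 * r)), 0 < r := fun j => by
    rcases Nat.eq_zero_or_pos r with rfl | h
    · exact absurd j.2 (by simp)
    · exact h
  have hB : ∀ j i, B j (σ i) = B j i := fun j => (hBmem j).2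
  choose p q hp hq hpq hS using fun j => exists_orbit_pair (hr j) σ hCyc {i | B j i = 1}
    (fun i => by simp [hB]) (hcard j)
  have hJ : ∀ i, ∃ j, B j i = 1 := fun i => by
    simpa using Set.ext_iff.1 hcover i
  choose J hJ using hJ
  have hJu : ∀ {i j}, B j i = 1 → J i = j := fun {i j} h => by
    by_contra hne
    exact Set.notMem_empty i (hdisj _ _ hne ▸ ⟨hJ i, h⟩)
  have hBJ : ∀ j i, B j i = if J i = j then 1 else 0 := fun j i => by
    split_ifs with h
    · exact h ▸ hJ i
    · have h01 : ∀ x : ZMod 2, x ≠ 1 → x = 0 := by decide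
      exact h01 _ fun h' => h (hJu h')
  have hJσ : ∀ i, J (σ i) = J i := fun i => hJu (by rw [hB]; exact hJ i)
  let P : Fin N → Prop := fun i => i ∈ MulAction.orbit (Subgroup.zpowers σ) (p (J i))
  have hPσ : ∀ i, P (σ i) ↔ P i := fun i => by
    change σ i ∈ _ ↔ _
    rw [hJσ]
    change σ i ∈ _ ↔ i ∈ _
    rw [← MulAction.orbit_eq_iff, ← MulAction.orbit_eq_iff,
      show MulAction.orbit (Subgroup.zpowers σ) (σ i) = MulAction.orbit (Subgroup.zpowers σ) i from
        MulAction.orbit_smul (⟨σ, Subgroup.mem_zpowers σ⟩ : Subgroup.zpowers σ) i]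
  have hJp : ∀ j, J (p j) = j := fun j => hJu (hp j)
  have hJq : ∀ j, J (q j) = j := fun j => hJu (hq j)
  have hPp : ∀ j, P (p j) := fun j => by
    change p j ∈ _
    rw [hJp]; exact MulAction.mem_orbit_self _
  have hPq : ∀ j, ¬ P (q j) := fun j h => by
    change q j ∈ _ at h
    rw [hJq] at h
    exact Set.disjoint_left.1 (hpq j) h (MulAction.mem_orbit_self _)
  have hQ : ∀ i, ¬ P i → i ∈ MulAction.orbit (Subgroup.zpowers σ) (q (J i)) := fun i h => by
    have h' : i ∈ {i' | B (J i) i' = 1} := hJ i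
    rw [hS] at h'
    exact h'.resolve_left h
  have hcardP : ∀ j, (Finset.univ.filter fun i => J i = j ∧ P i).card = r := fun j => by
    refine Eq.trans ?_ (hCyc (p j))
    rw [Nat.card_coe_set_eq, ← Set.ncard_coe_finset]
    congr 1
    ext i
    simp only [Finset.coe_filter, Finset.mem_univ, true_and, Set.mem_ofPred_eq]
    constructor
    · rintro ⟨rfl, h⟩; exact h
    · intro h
      have hj : J i = j := hJu (show i ∈ {i | B j i = 1} by rw [hS]; exact Or.inl h)
      exact ⟨hj, by change i ∈ _; rw [hj]; exact h⟩
  have hcardQ : ∀ j, (Finset.univ.filter fun i => J i = j ∧ ¬ P i).card = r := fun j => by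
    refine Eq.trans ?_ (hCyc (q j))
    rw [Nat.card_coe_set_eq, ← Set.ncard_coe_finset]
    congr 1
    ext i
    simp only [Finset.coe_filter, Finset.mem_univ, true_and, Set.mem_ofPred_eq]
    constructor
    · rintro ⟨rfl, h⟩; exact hQ i h
    · intro h
      have hj : J i = j := hJu (show i ∈ {i | B j i = 1} by rw [hS]; exact Or.inr h)
      refine ⟨hj, fun h' => ?_⟩
      change i ∈ _ at h'
      rw [hj] at h'
      exact Set.disjoint_left.1 (hpq j) h' h
  have hsum : ∀ x y : Fin (N / (2 * r)) → ℚ,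
      ∑ i, (if P i then x (J i) else y (J i)) = r * ∑ j, (x j + y j) := fun x y => by
    rw [← Finset.sum_fiberwise (s := Finset.univ) (g := J), Finset.mul_sum]
    refine Finset.sum_congr rfl fun j _ => ?_
    rw [Finset.sum_ite, Finset.filter_filter, Finset.filter_filter,
      Finset.sum_congr rfl (f := fun i => x (J i)) (g := fun _ => x j)
        (fun i hi => by rw [(Finset.mem_filter.1 hi).2.1]),
      Finset.sum_congr rfl (f := fun i => y (J i)) (g := fun _ => y j)
        (fun i hi => by rw [(Finset.mem_filter.1 hi).2.1])]
    simp [hcardP, hcardQ, mul_add]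
  have hN : N = r * (N / (2 * r) + N / (2 * r)) := by
    have := hsum (fun _ => 1) (fun _ => 1)
    simp only [ite_self, Finset.sum_const, Finset.card_univ, Fintype.card_fin, nsmul_eq_mul,
      mul_one] at this
    have h2 : (N : ℚ) = ((r * (N / (2 * r) + N / (2 * r)) : ℕ) : ℚ) := by
      rw [this]; push_cast; ring
    exact_mod_cast h2
  have hM : N / r = N / (2 * r) + N / (2 * r) := by
    rcases Nat.eq_zero_or_pos r with h0 | h0
    · simp [h0]
    · exact Nat.div_eq_of_eq_mul_right h0 hN
  intro k
  rw [card_sum_sq_eq_pairs hM]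
  symm
  let F : (Fin (N / (2 * r)) → ℤ) × (Fin (N / (2 * r)) → ℤ) → Fin N → ℚ := fun x i =>
    if P i then ((x.1 (J i) : ℚ) + x.2 (J i)) / 2 else ((x.1 (J i) : ℚ) - x.2 (J i)) / 2
  have hFnorm : ∀ x, ∑ i, F x i * F x i =
      r * ∑ j, ((x.1 j : ℚ) ^ 2 + (x.2 j : ℚ) ^ 2) / 2 := fun x => by
    rw [← Finset.sum_congr rfl (fun j _ => show
      (((x.1 j : ℚ) + x.2 j) / 2) ^ 2 + (((x.1 j : ℚ) - x.2 j) / 2) ^ 2 = _ by ring), ← hsum]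
    refine Finset.sum_congr rfl fun i _ => ?_
    simp only [F]
    split_ifs <;> ring
  have hFnorm' : ∀ x, (r * ∑ j, ((x.1 j : ℚ) ^ 2 + (x.2 j : ℚ) ^ 2) = 2 * k) ↔
      ∑ i, F x i * F x i = k := fun x => by
    rw [hFnorm, ← Finset.sum_div]
    constructor <;> intro h <;> linarith
  have hFmem : ∀ x, F x ∈ codeLattice C := fun x => by
    refine ⟨fun i => if P i then x.1 (J i) + x.2 (J i) else x.1 (J i) - x.2 (J i),
      fun i => ?_, ?_⟩
    · simp only [F]
      split_ifs <;> push_cast <;> ring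
    · have : (fun i => ((if P i then x.1 (J i) + x.2 (J i) else x.1 (J i) - x.2 (J i) : ℤ) :
          ZMod 2)) = ∑ j, ((x.1 j : ZMod 2) + x.2 j) • B j := by
        ext i
        simp only [Finset.sum_apply, Pi.smul_apply, hBJ, smul_eq_mul, mul_ite, mul_one, mul_zero,
          Finset.sum_ite_eq, Finset.mem_univ, if_true]
        split_ifs
        · push_cast; rfl
        · push_cast; rw [CharTwo.sub_eq_add]
      rw [this]
      exact C.sum_mem fun j _ => C.smul_mem _ (hBmem j).1
  have hFσ : ∀ x i, F x (σ i) = F x i := fun x i => by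
    simp only [F, hJσ, hPσ]
  refine Nat.card_eq_of_bijective (fun x => ⟨F x.1, hFmem _, hFσ _, (hFnorm' _).1 x.2⟩) ⟨?_, ?_⟩
  · rintro ⟨x, hx⟩ ⟨y, hy⟩ h
    have h' : F x = F y := congrArg Subtype.val h
    have key : ∀ j, x.1 j = y.1 j ∧ x.2 j = y.2 j := fun j => by
      have h1 := congrFun h' (p j)
      have h2 := congrFun h' (q j)
      simp only [F, hPp, hPq, hJp, hJq, if_true, if_false] at h1 h2
      constructor
      · have : (x.1 j : ℚ) = y.1 j := by linarith
        exact_mod_cast this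
      · have : (x.2 j : ℚ) = y.2 j := by linarith
        exact_mod_cast this
    exact Subtype.ext (Prod.ext (funext fun j => (key j).1) (funext fun j => (key j).2))
  · rintro ⟨c, ⟨a, hca, haC⟩, hcσ, hck⟩
    have haσ : ∀ i, a (σ i) = a i := fun i => by
      have : (a (σ i) : ℚ) = a i := by rw [← hca, ← hca, hcσ]
      exact_mod_cast this
    have hmem : (fun i => (a i : ZMod 2)) ∈ Submodule.span (ZMod 2) (Set.range B) := by
      rw [hspan]
      exact ⟨haC, fun i => by simp only [haσ]⟩
    obtain ⟨w, hw⟩ := (Submodule.mem_span_range_iff_exists_fun _).1 hmem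
    have hwa : ∀ i, (a i : ZMod 2) = w (J i) := fun i => by
      rw [← congrFun hw i]
      simp [Finset.sum_apply, hBJ]
    have hpar : ∀ j, ∃ d, a (p j) - a (q j) = 2 * d := fun j => by
      have : ((a (p j) - a (q j) : ℤ) : ZMod 2) = 0 := by
        push_cast
        rw [hwa, hwa, hJp, hJq, sub_self]
      exact_mod_cast (ZMod.intCast_zmod_eq_zero_iff_dvd _ 2).1 this
    choose d hd using hpar
    have hFc : F (fun j => a (q j) + d j, d) = c := by
      ext i
      have hi := hca i
      simp only [F]
      split_ifs with h
      · have h1 : a i = a (p (J i)) := eq_of_mem_orbit_zpowers haσ h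
        have h2 : (a (p (J i)) : ℚ) - a (q (J i)) = 2 * d (J i) := by exact_mod_cast hd (J i)
        rw [h1] at hi
        push_cast
        linarith
      · have h1 : a i = a (q (J i)) := eq_of_mem_orbit_zpowers haσ (hQ i h)
        rw [h1] at hi
        push_cast
        linarith
    exact ⟨⟨(fun j => a (q j) + d j, d), (hFnorm' _).2 (by rw [hFc]; exact hck)⟩,
      Subtype.ext hFc⟩
end

section
/- Let C be a doubly even self-dual binary linear code of length N and let σ be an automorphism of C of cycle type 2^{N/2}, i.e., every orbit of ⟨σ⟩ on Fin N has cardinality 2. Suppose the fixed subcode C^σ has 𝔽₂-dimension N/4 + 1 and is spanned by codewords B₀, B₁, …, B_{N/4} such that |supp B₀| = N/2, |supp B_j| = 4 for 1 ≤ j ≤ N/4, supp B_i ∩ supp B_j = ∅ for 1 ≤ i < j ≤ N/4, and |supp B₀ ∩ supp B_j| = 2 for 1 ≤ j ≤ N/4. Then the theta series of the fixed sublattice L(C)^σ equals ϑ₃(q²)^{N/2} + ϑ₂(q²)^{N/2}, the theta series of D_{N/2}*(2); concretely, for every k ∈ ℚ, the number of c ∈ L(C) with c(σ(i)) = c(i)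 for all i and ∑ᵢ (c i)² = k equals (the number of n : Fin (N/2) → ℤ with ∑ⱼ (n j)² = k) plus (the number of n : Fin (N/2) → ℤ with ∑ⱼ (2·n j + 1)² = 4k). -/
/-- A permutation all of whose cycles have length two is a fixed-point-free involution. -/
theorem Equiv.Perm.involutive_and_ne_of_card_orbit_eq_two {α : Type*} [Finite α]
    (σ : Equiv.Perm α)
    (h : ∀ i : α, Nat.card (MulAction.orbit (Subgroup.zpowers σ) i) = 2) :
    Function.Involutive σ ∧ ∀ i, σ i ≠ i := by
  classical
  have key : ∀ i, Function.minimalPeriod (σ • · : α → α) i = 2 := fun i => by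
    have : Fintype (MulAction.orbit (Subgroup.zpowers σ) i) := Fintype.ofFinite _
    rw [MulAction.minimalPeriod_eq_card, ← Nat.card_eq_fintype_card, h i]
  refine ⟨fun i => ?_, fun i hi => ?_⟩
  · have := Function.iterate_minimalPeriod (f := (σ • · : α → α)) (x := i)
    rw [key i] at this
    simpa using this
  · have : Function.minimalPeriod (σ • · : α → α) i = 1 :=
      Function.minimalPeriod_eq_one_iff_isFixedPt.2 hi
    rw [key i] at this
    omega

/-- A finite type with a fixed-point-free involution has even cardinality. -/
theorem Function.Involutive.even_card_of_forall_ne {α : Type*} [Fintype α] {f : α → α}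
    (hf : Function.Involutive f) (hne : ∀ i, f i ≠ i) : Even (Fintype.card α) := by
  rw [← ZMod.natCast_eq_zero_iff_even]
  have : ∑ _i : α, (1 : ZMod 2) = 0 :=
    Finset.sum_involution (fun i _ => f i) (fun _ _ => by decide) (fun i _ _ => hne i)
      (fun _ _ => Finset.mem_univ _) (fun i _ => hf i)
  simpa using this

theorem ZMod.eq_zero_of_ne_one_two {x : ZMod 2} (h : x ≠ 1) : x = 0 := by
  revert x; decide

/-- Coordinates adapted to a fixed-point-free involution `σ` and `σ`-invariant words `B0`, `B j`,
where the `B j` have disjoint supports of size four, each of which meets the support of `B0` in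
two points: the block `B j` consists of one `σ`-orbit inside the support of `B0` and one outside. -/
theorem exists_block_coordinates {α J : Type*} [Fintype α] [Fintype J] [DecidableEq J]
    {σ : α → α} (hσ : Function.Involutive σ) (hne : ∀ i, σ i ≠ i)
    {B0 : α → ZMod 2} {B : J → α → ZMod 2}
    (hB0 : ∀ i, B0 (σ i) = B0 i) (hB : ∀ j i, B j (σ i) = B j i)
    (hBcard : ∀ j, Nat.card {i | B j i = 1} = 4)
    (hdisj : ∀ j k, j ≠ k → {i | B j i = 1} ∩ {i | B k i = 1} = ∅)
    (hint : ∀ j, Nat.card ({i | B0 i = 1} ∩ {i | B j i = 1} : Set α) = 2)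
    (hcard : Fintype.card J * 4 = Fintype.card α) :
    ∃ f : J × Bool × Bool ≃ α, (∀ j b s, σ (f (j, b, s)) = f (j, b, !s)) ∧
      (∀ j b s, B0 (f (j, b, s)) = if b then 1 else 0) ∧
      ∀ k j b s, B k (f (j, b, s)) = if k = j then 1 else 0 := by
  have hp : ∀ j, ∃ i, B0 i = 1 ∧ B j i = 1 := fun j => by
    by_contra! hcon
    have : ({i | B0 i = 1} ∩ {i | B j i = 1} : Set α) = ∅ := by
      ext i; simpa using hcon i
    have h2 := hint j
    rw [this] at h2
    simp at h2
  have hq : ∀ j, ∃ i, B0 i = 0 ∧ B j i = 1 := fun j => by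
    by_contra! hcon
    have : ({i | B0 i = 1} ∩ {i | B j i = 1} : Set α) = {i | B j i = 1} := by
      refine Set.inter_eq_right.2 fun i hi => ?_
      by_contra h0
      exact hcon i (ZMod.eq_zero_of_ne_one_two h0) hi
    have h2 := hint j
    rw [this, hBcard j] at h2
    omega
  choose p hp0 hpB using hp
  choose q hq0 hqB using hq
  let F : J × Bool × Bool → α := fun x =>
    (if x.2.2 then σ else id) (if x.2.1 then p x.1 else q x.1)
  have hF0 : ∀ j b s, B0 (F (j, b, s)) = if b then 1 else 0 := fun j b s => by
    cases b <;> cases s <;> simp [F, hB0, hp0, hq0]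
  have hFB' : ∀ j b s, B j (F (j, b, s)) = 1 := fun j b s => by
    cases b <;> cases s <;> simp [F, hB, hpB, hqB]
  have hFB : ∀ k j b s, B k (F (j, b, s)) = if k = j then 1 else 0 := fun k j b s => by
    split_ifs with hkj
    · exact hkj ▸ hFB' j b s
    · refine ZMod.eq_zero_of_ne_one_two fun h1 => ?_
      have : F (j, b, s) ∈ ({i | B k i = 1} ∩ {i | B j i = 1} : Set α) := ⟨h1, hFB' j b s⟩
      simp [hdisj k j hkj] at this
  have hinj : Function.Injective F := by
    rintro ⟨j, b, s⟩ ⟨k, c, t⟩ h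
    have hjk : j = k := by
      by_contra hjk
      have h1 := hFB' j b s
      rw [h, hFB, if_neg hjk] at h1
      exact absurd h1 (by decide)
    subst hjk
    have hbc : b = c := by
      have h1 := hF0 j b s
      rw [h, hF0] at h1
      revert h1
      cases b <;> cases c <;> simp
    subst hbc
    have hst : s = t := by
      revert h
      cases s <;> cases t <;> simp [F, hne, (hne _).symm]
    rw [hst]
  have hbij : Function.Bijective F :=
    (Fintype.bijective_iff_injective_and_card F).2 ⟨hinj, by simp; omega⟩
  refine ⟨Equiv.ofBijective F hbij, fun j b s => ?_, hF0, hFB⟩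
  cases s <;> simp [F, hσ _]

/-- A `σ`-invariant word lies in a code whose `σ`-fixed subcode is spanned by `B0` and the `B j` if
and only if the sum of its values at the two orbits of a block does not depend on the block. -/
theorem mem_iff_of_span_eq_fixedSubcode {N : ℕ} {J : Type*} [Fintype J] [DecidableEq J]
    {C : Submodule (ZMod 2) (Fin N → ZMod 2)} {σ : Equiv.Perm (Fin N)}
    {B0 : Fin N → ZMod 2} {B : J → Fin N → ZMod 2}
    (hspan : Submodule.span (ZMod 2) ({B0} ∪ Set.range B) = fixedSubcode C σ)
    (f : J × Bool × Bool ≃ Fin N) (hfσ : ∀ j b s, σ (f (j, b, s)) = f (j, b, !s))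
    (hf0 : ∀ j b s, B0 (f (j, b, s)) = if b then 1 else 0)
    (hfB : ∀ k j b s, B k (f (j, b, s)) = if k = j then 1 else 0)
    {v : Fin N → ZMod 2} (hv : ∀ i, v (σ i) = v i) :
    v ∈ C ↔ ∃ e, ∀ j, v (f (j, true, false)) + v (f (j, false, false)) = e := by
  constructor
  · intro hC
    have hmem : v ∈ Submodule.span (ZMod 2) ({B0} ∪ Set.range B) := hspan ▸ ⟨hC, hv⟩
    clear hC hv
    induction hmem using Submodule.span_induction with
    | mem x hx =>
      rcases hx with rfl | ⟨k, rfl⟩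
      · exact ⟨1, fun j => by simp [hf0]⟩
      · exact ⟨0, fun j => by rw [hfB, hfB]; exact CharTwo.add_self_eq_zero _⟩
    | zero => exact ⟨0, fun j => by simp⟩
    | add x y _ _ hx hy =>
      obtain ⟨e, he⟩ := hx
      obtain ⟨e', he'⟩ := hy
      exact ⟨e + e', fun j => by rw [← he j, ← he' j]; simp only [Pi.add_apply]; ring⟩
    | smul a x _ hx =>
      obtain ⟨e, he⟩ := hx
      exact ⟨a * e, fun j => by rw [← he j]; simp only [Pi.smul_apply, smul_eq_mul]; ring⟩
  · rintro ⟨e, he⟩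
    have hB0 : B0 ∈ fixedSubcode C σ := hspan ▸ Submodule.subset_span (Or.inl rfl)
    have hB : ∀ j, B j ∈ fixedSubcode C σ := fun j =>
      hspan ▸ Submodule.subset_span (Or.inr ⟨j, rfl⟩)
    have hveq : v = e • B0 + ∑ j, v (f (j, false, false)) • B j := by
      ext i
      obtain ⟨⟨j, b, s⟩, rfl⟩ := f.surjective i
      have hs : v (f (j, b, s)) = v (f (j, b, false)) := by
        cases s
        · rfl
        · simpa [hfσ] using hv (f (j, b, false))
      rw [hs]
      simp only [Pi.add_apply, Pi.smul_apply, Finset.sum_apply, hf0, hfB, smul_eq_mul,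
        mul_ite, mul_one, mul_zero, Finset.sum_ite_eq', Finset.mem_univ, if_true]
      cases b
      · simp
      · simp only [if_true, ← he j]
        rw [add_assoc, CharTwo.add_self_eq_zero, add_zero]
    rw [hveq]
    exact C.add_mem (C.smul_mem _ hB0.1) (C.sum_mem fun j _ => C.smul_mem _ (hB j).1)

/-- The `σ`-invariant vector which takes the values `(y (j, true) ± y (j, false)) / 2` on the two
orbits of the block `j`. -/
def rotatedVector {α J : Type*} (f : J × Bool × Bool ≃ α) (y : J × Bool → ℚ) : α → ℚ :=
  fun i => (y ((f.symm i).1, true) +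
    (if (f.symm i).2.1 then 1 else -1) * y ((f.symm i).1, false)) / 2

theorem rotatedVector_apply {α J : Type*} (f : J × Bool × Bool ≃ α) (y : J × Bool → ℚ)
    (j : J) (b s : Bool) : rotatedVector f y (f (j, b, s)) =
      (y (j, true) + (if b then 1 else -1) * y (j, false)) / 2 := by
  simp [rotatedVector]

theorem rotatedVector_injective {α J : Type*} (f : J × Bool × Bool ≃ α) :
    Function.Injective (rotatedVector f) := by
  intro y z h
  ext ⟨j, b⟩
  have h1 := congrFun h (f (j, true, true))
  have h2 := congrFun h (f (j, false, true))
  simp only [rotatedVector_apply, if_true, Bool.false_eq_true, if_false] at h1 h2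
  cases b <;> linarith

theorem sum_rotatedVector_mul_self {α J : Type*} [Fintype α] [Fintype J]
    (f : J × Bool × Bool ≃ α) (y : J × Bool → ℚ) :
    ∑ i, rotatedVector f y i * rotatedVector f y i = ∑ x, y x ^ 2 := by
  rw [← f.sum_comp, Fintype.sum_prod_type, Fintype.sum_prod_type]
  refine Finset.sum_congr rfl fun j _ => ?_
  simp only [Fintype.sum_prod_type, Fintype.sum_bool, rotatedVector_apply]
  simp only [if_true, Bool.false_eq_true, if_false]
  ring

theorem exists_eq_rotatedVector {α J : Type*} {σ : α → α} (f : J × Bool × Bool ≃ α)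
    (hfσ : ∀ j b s, σ (f (j, b, s)) = f (j, b, !s)) {c : α → ℚ} (hc : ∀ i, c (σ i) = c i) :
    ∃ y, c = rotatedVector f y := by
  refine ⟨fun x => c (f (x.1, true, false)) +
    (if x.2 then 1 else -1) * c (f (x.1, false, false)), ?_⟩
  ext i
  obtain ⟨⟨j, b, s⟩, rfl⟩ := f.surjective i
  have hs : c (f (j, b, s)) = c (f (j, b, false)) := by
    cases s
    · rfl
    · simpa [hfσ] using hc (f (j, b, false))
  rw [hs, rotatedVector_apply]
  cases b <;> simp <;> ring

theorem rotatedVector_comp {α J : Type*} {σ : α → α} (f : J × Bool × Bool ≃ α)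
    (hfσ : ∀ j b s, σ (f (j, b, s)) = f (j, b, !s)) (y : J × Bool → ℚ) (i : α) :
    rotatedVector f y (σ i) = rotatedVector f y i := by
  obtain ⟨⟨j, b, s⟩, rfl⟩ := f.surjective i
  rw [hfσ, rotatedVector_apply, rotatedVector_apply]

/-- In the rotated coordinates the fixed sublattice is the union of `ℤ^m` and its translate by the
vector with all coordinates `1 / 2`. -/
theorem rotatedVector_mem_codeLattice_iff {N : ℕ} {J : Type*}
    {C : Submodule (ZMod 2) (Fin N → ZMod 2)} {σ : Equiv.Perm (Fin N)}
    (f : J × Bool × Bool ≃ Fin N) (hfσ : ∀ j b s, σ (f (j, b, s)) = f (j, b, !s))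
    (hC : ∀ v : Fin N → ZMod 2, (∀ i, v (σ i) = v i) →
      (v ∈ C ↔ ∃ e, ∀ j, v (f (j, true, false)) + v (f (j, false, false)) = e))
    (y : J × Bool → ℚ) :
    rotatedVector f y ∈ codeLattice C ↔
      (∃ n : J × Bool → ℤ, y = fun x => (n x : ℚ)) ∨
      ∃ n : J × Bool → ℤ, y = fun x => (n x : ℚ) + 1 / 2 := by
  constructor
  · rintro ⟨a, ha, haC⟩
    have haσ : ∀ i, a (σ i) = a i := fun i => by
      have h1 := ha (σ i)
      rw [rotatedVector_comp f hfσ, ha i] at h1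
      exact_mod_cast h1.symm
    obtain ⟨e, he⟩ := (hC _ fun i => by simp only [haσ]).1 haC
    have hT : ∀ j, y (j, true) =
        ((a (f (j, true, false)) : ℚ) + a (f (j, false, false))) / 2 := fun j => by
      rw [← ha, ← ha, rotatedVector_apply, rotatedVector_apply]
      simp only [if_true, Bool.false_eq_true, if_false]
      ring
    have hF : ∀ j, y (j, false) =
        ((a (f (j, true, false)) : ℚ) - a (f (j, false, false))) / 2 := fun j => by
      rw [← ha, ← ha, rotatedVector_apply, rotatedVector_apply]
      simp only [if_true, Bool.false_eq_true, if_false]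
      ring
    simp only [← Int.cast_add] at he
    obtain rfl | rfl : e = 0 ∨ e = 1 :=
      or_iff_not_imp_right.2 ZMod.eq_zero_of_ne_one_two
    · left
      have h2 : ∀ j, ∃ m, a (f (j, true, false)) + a (f (j, false, false)) = 2 * m := fun j =>
        (ZMod.intCast_zmod_eq_zero_iff_dvd _ 2).1 (he j)
      choose m hm using h2
      refine ⟨fun x => if x.2 then m x.1 else m x.1 - a (f (x.1, false, false)), ?_⟩
      ext ⟨j, b⟩
      have hmj : (a (f (j, true, false)) : ℚ) + a (f (j, false, false)) = 2 * m j := by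
        exact_mod_cast hm j
      cases b
      · simp [hF]; linarith
      · simp [hT]; linarith
    · right
      have h2 : ∀ j, ∃ m, a (f (j, true, false)) + a (f (j, false, false)) - 1 = 2 * m :=
        fun j => (ZMod.intCast_zmod_eq_zero_iff_dvd _ 2).1 (by
          rw [Int.cast_sub, he j]; simp)
      choose m hm using h2
      refine ⟨fun x => if x.2 then m x.1 else m x.1 - a (f (x.1, false, false)), ?_⟩
      ext ⟨j, b⟩
      have hmj : (a (f (j, true, false)) : ℚ) + a (f (j, false, false)) - 1 = 2 * m j := by
        exact_mod_cast hm j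
      cases b
      · simp [hF]; linarith
      · simp [hT]; linarith
  · have htwo : ∀ z w : ℤ, ((z + w : ℤ) : ZMod 2) + ((z - w : ℤ) : ZMod 2) = 0 := fun z w => by
      rw [← Int.cast_add, add_add_sub_cancel, Int.cast_add, CharTwo.add_self_eq_zero]
    rintro (⟨n, rfl⟩ | ⟨n, rfl⟩)
    · refine ⟨fun i => n ((f.symm i).1, true) +
        (if (f.symm i).2.1 then 1 else -1) * n ((f.symm i).1, false), fun i => ?_, ?_⟩
      · simp only [rotatedVector]
        split_ifs <;> push_cast <;> ring
      · refine (hC _ fun i => ?_).2 ⟨0, fun j => ?_⟩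
        · obtain ⟨⟨j, b, s⟩, rfl⟩ := f.surjective i
          simp [hfσ]
        · simpa [sub_eq_add_neg] using htwo (n (j, true)) (n (j, false))
    · refine ⟨fun i => n ((f.symm i).1, true) +
        (if (f.symm i).2.1 then n ((f.symm i).1, false) + 1 else - n ((f.symm i).1, false)),
        fun i => ?_, ?_⟩
      · simp only [rotatedVector]
        split_ifs <;> push_cast <;> ring
      · refine (hC _ fun i => ?_).2 ⟨1, fun j => ?_⟩
        · obtain ⟨⟨j, b, s⟩, rfl⟩ := f.surjective i
          simp [hfσ]
        · have := htwo (n (j, true)) (n (j, false))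
          simp only [Equiv.symm_apply_apply, if_true, Bool.false_eq_true, if_false]
          push_cast at this ⊢
          linear_combination this

/-- Only finitely many integer vectors have a given sum of squares. -/
theorem finite_sum_sq_eq {I : Type*} [Fintype I] (k : ℚ) :
    Finite {n : I → ℤ // ((∑ j, (n j) ^ 2 : ℤ) : ℚ) = k} := by
  classical
  refine Set.Finite.subset (Set.finite_Icc (fun _ : I => -⌊k⌋) (fun _ => ⌊k⌋)) ?_
  intro n hn
  have hn' : (∑ j, (n j) ^ 2 : ℤ) = ⌊k⌋ := by
    rw [← show ((∑ j, (n j) ^ 2 : ℤ) : ℚ) = k from hn, Int.floor_intCast]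
  have hb : ∀ j, |n j| ≤ ⌊k⌋ := fun j => by
    rw [← hn']
    calc |n j| ≤ |n j| ^ 2 := Int.le_self_sq _
      _ = n j ^ 2 := sq_abs _
      _ ≤ _ := Finset.single_le_sum (f := fun j => n j ^ 2) (fun i _ => sq_nonneg _)
        (Finset.mem_univ j)
  exact ⟨fun j => (abs_le.1 (hb j)).1, fun j => (abs_le.1 (hb j)).2⟩

theorem finite_sum_odd_sq_eq {I : Type*} [Fintype I] (k : ℚ) :
    Finite {n : I → ℤ // ((∑ j, (2 * n j + 1) ^ 2 : ℤ) : ℚ) = k} := by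
  have := finite_sum_sq_eq (I := I) k
  refine Finite.of_injective (β := {n : I → ℤ // ((∑ j, (n j) ^ 2 : ℤ) : ℚ) = k})
    (fun n => ⟨fun j => 2 * n.1 j + 1, n.2⟩) fun n m h => ?_
  ext j
  have := congrFun (congrArg Subtype.val h) j
  simp only at this
  omega

theorem card_fixed_codeLattice_eq {N : ℕ} {J : Type*} [Fintype J] [Nonempty J]
    {C : Submodule (ZMod 2) (Fin N → ZMod 2)} {σ : Equiv.Perm (Fin N)}
    (f : J × Bool × Bool ≃ Fin N) (hfσ : ∀ j b s, σ (f (j, b, s)) = f (j, b, !s))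
    (hC : ∀ v : Fin N → ZMod 2, (∀ i, v (σ i) = v i) →
      (v ∈ C ↔ ∃ e, ∀ j, v (f (j, true, false)) + v (f (j, false, false)) = e))
    (k : ℚ) :
    Nat.card {c : Fin N → ℚ //
        c ∈ codeLattice C ∧ (∀ i, c (σ i) = c i) ∧ ∑ i, c i * c i = k}
      = Nat.card {n : J × Bool → ℤ // ((∑ j, (n j) ^ 2 : ℤ) : ℚ) = k}
        + Nat.card {n : J × Bool → ℤ // ((∑ j, (2 * n j + 1) ^ 2 : ℤ) : ℚ) = 4 * k} := by
  have := finite_sum_sq_eq (I := J × Bool) k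
  have := finite_sum_odd_sq_eq (I := J × Bool) (4 * k)
  have hmem := rotatedVector_mem_codeLattice_iff f hfσ hC
  have hhalf : ∀ n : J × Bool → ℤ, ∑ x, ((n x : ℚ) + 1 / 2) ^ 2 = k ↔
      ((∑ j, (2 * n j + 1) ^ 2 : ℤ) : ℚ) = 4 * k := fun n => by
    have : ((∑ j, (2 * n j + 1) ^ 2 : ℤ) : ℚ) = 4 * ∑ x, ((n x : ℚ) + 1 / 2) ^ 2 := by
      push_cast
      rw [Finset.mul_sum]
      exact Finset.sum_congr rfl fun x _ => by ring
    rw [this]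
    exact (mul_right_inj' (by norm_num)).symm
  rw [← Nat.card_sum]
  symm
  refine Nat.card_eq_of_bijective (Sum.elim
    (fun n => ⟨rotatedVector f fun x => (n.1 x : ℚ), (hmem _).2 (Or.inl ⟨n.1, rfl⟩),
      rotatedVector_comp f hfσ _, by
        rw [sum_rotatedVector_mul_self]; exact_mod_cast n.2⟩)
    (fun n => ⟨rotatedVector f fun x => (n.1 x : ℚ) + 1 / 2, (hmem _).2 (Or.inr ⟨n.1, rfl⟩),
      rotatedVector_comp f hfσ _, by
        rw [sum_rotatedVector_mul_self]; exact (hhalf n.1).2 n.2⟩)) ⟨?_, ?_⟩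
  · refine Function.Injective.sumElim ?_ ?_ ?_
    · intro n m h
      have h1 : (fun x => (n.1 x : ℚ)) = fun x => (m.1 x : ℚ) :=
        rotatedVector_injective f (Subtype.ext_iff.1 h)
      ext x
      exact_mod_cast congrFun h1 x
    · intro n m h
      have h1 : (fun x => (n.1 x : ℚ) + 1 / 2) = fun x => (m.1 x : ℚ) + 1 / 2 :=
        rotatedVector_injective f (Subtype.ext_iff.1 h)
      ext x
      have h2 := congrFun h1 x
      simp only [add_left_inj] at h2
      exact_mod_cast h2
    · intro n m h
      have h1 : (fun x => (n.1 x : ℚ)) = fun x => (m.1 x : ℚ) + 1 / 2 :=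
        rotatedVector_injective f (Subtype.ext_iff.1 h)
      have h2 := congrFun h1 (Classical.arbitrary _)
      have h3 : (2 * n.1 (Classical.arbitrary _) : ℚ) = 2 * m.1 (Classical.arbitrary _) + 1 := by
        rw [h2]; ring
      have h4 : 2 * n.1 (Classical.arbitrary _) = 2 * m.1 (Classical.arbitrary _) + 1 := by
        exact_mod_cast h3
      omega
  · rintro ⟨c, hc, hcσ, hck⟩
    obtain ⟨y, rfl⟩ := exists_eq_rotatedVector f hfσ hcσ
    rw [sum_rotatedVector_mul_self] at hck
    rcases (hmem y).1 hc with ⟨n, rfl⟩ | ⟨n, rfl⟩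
    · exact ⟨Sum.inl ⟨n, by push_cast; exact hck⟩, rfl⟩
    · exact ⟨Sum.inr ⟨n, (hhalf n).1 hck⟩, rfl⟩

/-- Proposition 6.4 of the paper: let `C` be a doubly even self-dual binary
linear code of length `N` and `σ ∈ Aut C` of cycle type `2^{N/2}`.  If `C^σ` has
dimension `N/4 + 1` and is spanned by `B₀, B₁, …, B_{N/4}` with
`|supp B₀| = N/2`, `|supp B_j| = 4`, the `supp B_j` (`j ≥ 1`) pairwise disjoint
and `|supp B₀ ∩ supp B_j| = 2`, then the fixed sublattice `L(C)^σ` has theta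
series `ϑ₃(q²)^{N/2} + ϑ₂(q²)^{N/2}`, the theta series of `D*_{N/2}(2)`: for
each `k ∈ ℚ`, the number of `c ∈ L(C)^σ` with `∑ᵢ (c i)² = k` equals the number
of `n : Fin (N/2) → ℤ` with `∑ⱼ (n j)² = k` plus the number with
`∑ⱼ (2 n j + 1)² = 4k`. -/
theorem stmt_5 {N : ℕ}
    (C : Submodule (ZMod 2) (Fin N → ZMod 2))
    (hDE : ∀ v ∈ C, 4 ∣ (Finset.filter (fun i => v i ≠ 0) Finset.univ).card)
    (hSD : ∀ x : Fin N → ZMod 2, x ∈ C ↔ ∀ c ∈ C, ∑ i, x i * c i = 0)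
    (σ : Equiv.Perm (Fin N))
    (hAut : ∀ v ∈ C, (fun i => v (σ⁻¹ i)) ∈ C)
    (hCyc : ∀ i : Fin N, Nat.card (MulAction.orbit (Subgroup.zpowers σ) i) = 2)
    (hdim : Module.finrank (ZMod 2) (fixedSubcode C σ) = N / 4 + 1)
    (B0 : Fin N → ZMod 2) (B : Fin (N / 4) → (Fin N → ZMod 2))
    (hB0mem : B0 ∈ fixedSubcode C σ)
    (hBmem : ∀ j, B j ∈ fixedSubcode C σ)
    (hspan : Submodule.span (ZMod 2) ({B0} ∪ Set.range B) = fixedSubcode C σ)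
    (hB0card : Nat.card {i | B0 i = 1} = N / 2)
    (hBcard : ∀ j, Nat.card {i | B j i = 1} = 4)
    (hdisj : ∀ j k, j ≠ k → {i | B j i = 1} ∩ {i | B k i = 1} = ∅)
    (hint : ∀ j, Nat.card ({i | B0 i = 1} ∩ {i | B j i = 1} : Set (Fin N)) = 2) :
    ∀ k : ℚ,
      Nat.card {c : Fin N → ℚ //
        c ∈ codeLattice C ∧ (∀ i, c (σ i) = c i) ∧ ∑ i, c i * c i = k}
      = Nat.card {n : Fin (N / 2) → ℤ // ((∑ j, (n j) ^ 2 : ℤ) : ℚ) = k}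
        + Nat.card {n : Fin (N / 2) → ℤ //
            ((∑ j, (2 * n j + 1) ^ 2 : ℤ) : ℚ) = 4 * k} := by
  obtain ⟨hinv, hne⟩ := σ.involutive_and_ne_of_card_orbit_eq_two hCyc
  have heven : Even N := by simpa using hinv.even_card_of_forall_ne hne
  have hfour : 4 ∣ N / 2 := by
    have h1 : (Finset.univ.filter fun i => B0 i ≠ 0) = Finset.univ.filter fun i => B0 i = 1 := by
      refine Finset.filter_congr fun i _ => ?_
      generalize B0 i = x
      revert x
      decide
    have h2 := hDE B0 hB0mem.1
    rw [h1] at h2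
    rw [← hB0card]
    simpa [Nat.card_eq_fintype_card, Fintype.card_subtype] using h2
  have hN : N ≠ 0 := by
    rintro rfl
    have h1 := Module.finrank_zero_of_subsingleton (R := ZMod 2) (M := fixedSubcode C σ)
    omega
  obtain ⟨r, hr⟩ := heven
  have : Nonempty (Fin (N / 4)) := ⟨⟨0, by omega⟩⟩
  obtain ⟨f, hfσ, hf0, hfB⟩ := exists_block_coordinates (B0 := B0) (B := B) hinv hne hB0mem.2
    (fun j => (hBmem j).2) hBcard hdisj hint (by simp only [Fintype.card_fin]; omega)
  intro k
  rw [card_fixed_codeLattice_eq f hfσ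
    (fun v hv => mem_iff_of_span_eq_fixedSubcode hspan f hfσ hf0 hfB hv) k]
  have g : Fin (N / 4) × Bool ≃ Fin (N / 2) := Fintype.equivOfCardEq (by simp; omega)
  congr 1
  · refine Nat.card_congr ((g.arrowCongr (Equiv.refl ℤ)).subtypeEquiv fun n => ?_)
    rw [← g.sum_comp]
    simp
  · refine Nat.card_congr ((g.arrowCongr (Equiv.refl ℤ)).subtypeEquiv fun n => ?_)
    rw [← g.sum_comp]
    simp
end

section
/- Let C be a doubly even self-dual binary linear code of length N and let σ be an automorphism of C of order 2. Then the following are equivalent: (i) for every codeword B ∈ C, the cardinality of supp(B) ∩ σ(supp(B)) is divisible by 4; (ii) for every α ∈ L(C), the inner product ⟨α, σ • α⟩ = 2·∑ᵢ (α i)·(α (σ i)) lies in 2ℤ. -/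
/-- For an involution `σ`, the sum `∑ i, a i * a (σ i)` modulo 4 depends only on `a` modulo 2. -/
theorem sum_mul_comp_involution_modEq {ι : Type*} [Fintype ι] (σ : Equiv.Perm ι)
    (hσ : ∀ i, σ (σ i) = i) {a b : ι → ℤ} (h : ∀ i, a i ≡ b i [ZMOD 2]) :
    ∑ i, a i * a (σ i) ≡ ∑ i, b i * b (σ i) [ZMOD 4] := by
  choose d hd using fun i => (h i).dvd
  have hb : ∀ i, b i = a i + 2 * d i := fun i => by linarith [hd i]
  have hswap : ∑ i, d i * a (σ i) = ∑ i, a i * d (σ i) := by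
    rw [← Equiv.sum_comp σ]
    exact Finset.sum_congr rfl fun i _ => by rw [hσ, mul_comm]
  refine Int.modEq_iff_dvd.mpr ⟨∑ i, a i * d (σ i) + ∑ i, d i * d (σ i), ?_⟩
  have hexp : ∑ i, b i * b (σ i) = ∑ i, a i * a (σ i) + 2 * ∑ i, a i * d (σ i)
      + 2 * ∑ i, d i * a (σ i) + 4 * ∑ i, d i * d (σ i) := by
    simp only [Finset.mul_sum, ← Finset.sum_add_distrib]
    exact Finset.sum_congr rfl fun i _ => by rw [hb, hb]; ring
  rw [hexp, hswap]
  ring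

/-- The size of `supp B ∩ σ (supp B)` as a sum over integer representatives. -/
theorem sum_val_mul_val_eq_card {ι : Type*} [Fintype ι] (σ : Equiv.Perm ι)
    (B : ι → ZMod 2) :
    ∑ i, ((B i).val : ℤ) * ((B (σ i)).val : ℤ) =
      ((Finset.univ.filter fun i => B i = 1 ∧ B (σ i) = 1).card : ℤ) := by
  rw [Finset.card_filter, Nat.cast_sum]
  refine Finset.sum_congr rfl fun i _ => ?_
  generalize B i = x
  generalize B (σ i) = y
  revert x y
  decide

/-- Lemma 6.8 of the paper: for a doubly even self-dual binary linear code `C`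
of length `N` and an order-2 automorphism `σ` of `C`, one has
`|supp(B) ∩ σ(supp(B))| ≡ 0 (mod 4)` for all codewords `B ∈ C` iff
`⟨α, σ • α⟩ = 2·∑ᵢ (α i)·(α (σ i)) ∈ 2ℤ` for all `α` in the code-lattice
`L(C)`.  (Note `i ∈ σ(supp B) ↔ B (σ⁻¹ i) = 1`.) -/
theorem stmt_7 {N : ℕ}
    (C : Submodule (ZMod 2) (Fin N → ZMod 2))
    (hDE : ∀ v ∈ C, 4 ∣ (Finset.filter (fun i => v i ≠ 0) Finset.univ).card)
    (hSD : ∀ x : Fin N → ZMod 2, x ∈ C ↔ ∀ c ∈ C, ∑ i, x i * c i = 0)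
    (σ : Equiv.Perm (Fin N))
    (hAut : ∀ v ∈ C, (fun i => v (σ⁻¹ i)) ∈ C)
    (hord : orderOf σ = 2) :
    (∀ B ∈ C,
        4 ∣ (Finset.filter (fun i => B i = 1 ∧ B (σ⁻¹ i) = 1) Finset.univ).card) ↔
    (∀ α ∈ codeLattice C,
        ∃ m : ℤ, (2 * ∑ i, α i * α (σ i) : ℚ) = 2 * (m : ℚ)) := by
  have hσ : ∀ i, σ (σ i) = i := fun i => by
    have h2 : σ ^ 2 = 1 := hord ▸ pow_orderOf_eq_one σ
    simpa [sq] using congrArg (fun τ : Equiv.Perm (Fin N) => τ i) h2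
  have hinv : ∀ i, σ⁻¹ i = σ i := fun i => by rw [Equiv.Perm.inv_eq_iff_eq, hσ]
  simp only [hinv]
  have hform : ∀ (α : Fin N → ℚ) (a : Fin N → ℤ), (∀ i, 2 * α i = a i) →
      ((∃ m : ℤ, (2 * ∑ i, α i * α (σ i) : ℚ) = 2 * (m : ℚ)) ↔
        (4 : ℤ) ∣ ∑ i, a i * a (σ i)) := by
    intro α a ha
    have hsum : ((∑ i, a i * a (σ i) : ℤ) : ℚ) = 4 * ∑ i, α i * α (σ i) := by
      push_cast
      rw [Finset.mul_sum]
      exact Finset.sum_congr rfl fun i _ => by rw [← ha, ← ha]; ring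
    refine exists_congr fun m => ?_
    rw [← Int.cast_inj (α := ℚ), hsum]
    push_cast
    constructor <;> intro h <;> linarith
  constructor
  · rintro h α ⟨a, ha, haC⟩
    have hmod : ∀ i, a i ≡ (((a i : ZMod 2).val : ℕ) : ℤ) [ZMOD 2] := fun i =>
      (ZMod.intCast_eq_intCast_iff _ _ 2).mp (by simp)
    rw [hform α a ha, (sum_mul_comp_involution_modEq σ hσ hmod).dvd_iff,
      sum_val_mul_val_eq_card σ fun i => (a i : ZMod 2)]
    exact_mod_cast h _ haC
  · intro h B hB
    have hrep : ∀ i, 2 * (((B i).val : ℚ) / 2) = (((B i).val : ℤ) : ℚ) := fun i => by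
      push_cast
      ring
    have hdvd := (hform _ _ hrep).mp (h _ ⟨_, hrep, by simpa using hB⟩)
    rw [sum_val_mul_val_eq_card] at hdvd
    exact_mod_cast hdvd
end

section
/- Let C be a doubly even self-dual binary linear code of length N and let σ be an automorphism of C of even order m. Then ⟨α, σ^{m/2} • α⟩ ∈ 2ℤ for all α ∈ L(C) if and only if for every codeword B ∈ C the cardinality of supp(B) ∩ σ^{m/2}(supp(B)) is divisible by 4. (By Borcherds' criterion, the left-hand condition says exactly that the standard lift of the lattice automorphism induced by σ to the lattice vertex operator algebra V_{L(C)} does not have order doubling.) -/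
/-- For an involution `τ`, the twisted form `∑ i, a i * a (τ i)` modulo `4` depends only on
`a` modulo `2`. -/
theorem four_dvd_sum_mul_comp_sub {ι : Type*} [Fintype ι] (τ : Equiv.Perm ι)
    (hτ : Function.Involutive τ) (a b : ι → ℤ) (h : ∀ i, (2 : ℤ) ∣ a i - b i) :
    (4 : ℤ) ∣ ∑ i, a i * a (τ i) - ∑ i, b i * b (τ i) := by
  choose d hd using h
  have ha : ∀ i, a i = b i + 2 * d i := fun i => by linarith [hd i]
  have hsymm : ∑ i, b i * d (τ i) = ∑ i, d i * b (τ i) := by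
    rw [← Equiv.sum_comp τ]
    exact Finset.sum_congr rfl fun i _ => by rw [hτ i, mul_comm]
  refine ⟨∑ i, d i * b (τ i) + ∑ i, d i * d (τ i), ?_⟩
  have hexpand : ∑ i, a i * a (τ i) = ∑ i, b i * b (τ i) + 2 * ∑ i, b i * d (τ i)
      + 2 * ∑ i, d i * b (τ i) + 4 * ∑ i, d i * d (τ i) := by
    simp only [Finset.mul_sum, ← Finset.sum_add_distrib]
    exact Finset.sum_congr rfl fun i _ => by rw [ha, ha]; ring
  rw [hexpand, hsymm]
  ring

/-- The twisted form of a `0/1`-vector counts the intersection of the support with its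
translate. -/
theorem sum_ite_mul_ite_comp {ι R : Type*} [Fintype ι] [DecidableEq R] [One R]
    (τ : ι → ι) (B : ι → R) :
    ∑ i, (if B i = 1 then (1 : ℤ) else 0) * (if B (τ i) = 1 then 1 else 0) =
      (Finset.filter (fun i => B i = 1 ∧ B (τ i) = 1) Finset.univ).card := by
  rw [Finset.card_filter]
  push_cast
  exact Finset.sum_congr rfl fun i _ => by split_ifs <;> simp_all

/-- An integer agrees modulo `2` with the `0/1`-representative of its class. -/
theorem two_dvd_sub_ite_intCast (a : ℤ) :
    (2 : ℤ) ∣ a - if (a : ZMod 2) = 1 then 1 else 0 := by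
  refine (ZMod.intCast_zmod_eq_zero_iff_dvd _ 2).mp ?_
  push_cast
  generalize (a : ZMod 2) = x
  revert x
  decide

/-- The form on half-integral vectors is even exactly when the form on the doubled vectors is
divisible by `4`. -/
theorem exists_two_mul_sum_eq_iff {ι : Type*} [Fintype ι] (τ : ι → ι) (α : ι → ℚ) (a : ι → ℤ)
    (ha : ∀ i, 2 * α i = a i) :
    (∃ k : ℤ, (2 * ∑ i, α i * α (τ i) : ℚ) = 2 * (k : ℚ)) ↔ (4 : ℤ) ∣ ∑ i, a i * a (τ i) := by
  have h : ((∑ i, a i * a (τ i) : ℤ) : ℚ) = 4 * ∑ i, α i * α (τ i) := by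
    push_cast
    rw [Finset.mul_sum]
    exact Finset.sum_congr rfl fun i _ => by rw [← ha, ← ha]; ring
  refine exists_congr fun k => ?_
  rw [← @Int.cast_inj ℚ, h]
  push_cast
  constructor <;> intro hk <;> linarith

/-- Theorem 6.7 of the paper (code-theoretic characterization of order
doubling): let `C` be a doubly even self-dual binary linear code of length `N`
and `σ ∈ Aut C` of even order `m`.  Then `⟨α, σ^{m/2} • α⟩ ∈ 2ℤ` for all
`α ∈ L(C)` — by Borcherds' criterion, exactly the condition that the standard
lift of the induced lattice automorphism to `V_{L(C)}` does not have order
doubling — iff `|supp(B) ∩ σ^{m/2}(supp(B))| ≡ 0 (mod 4)` for every codeword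
`B ∈ C`. -/
theorem stmt_8 {N : ℕ}
    (C : Submodule (ZMod 2) (Fin N → ZMod 2))
    (hDE : ∀ v ∈ C, 4 ∣ (Finset.filter (fun i => v i ≠ 0) Finset.univ).card)
    (hSD : ∀ x : Fin N → ZMod 2, x ∈ C ↔ ∀ c ∈ C, ∑ i, x i * c i = 0)
    (σ : Equiv.Perm (Fin N))
    (hAut : ∀ v ∈ C, (fun i => v (σ⁻¹ i)) ∈ C)
    (m : ℕ) (hm : orderOf σ = m) (hEven : Even m) :
    (∀ α ∈ codeLattice C,
        ∃ k : ℤ, (2 * ∑ i, α i * α ((σ ^ (m / 2)) i) : ℚ) = 2 * (k : ℚ)) ↔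
    (∀ B ∈ C,
        4 ∣ (Finset.filter (fun i => B i = 1 ∧ B ((σ ^ (m / 2))⁻¹ i) = 1)
              Finset.univ).card) := by
  have hsq : σ ^ (m / 2) * σ ^ (m / 2) = 1 := by
    rw [← pow_add, ← two_mul, Nat.two_mul_div_two_of_even hEven, ← hm, pow_orderOf_eq_one]
  rw [inv_eq_of_mul_eq_one_left hsq]
  generalize σ ^ (m / 2) = τ at hsq
  have hτ : Function.Involutive τ := fun i => by rw [← Equiv.Perm.mul_apply, hsq]; rfl
  constructor
  · intro h B hB
    let b : Fin N → ℤ := fun i => if B i = 1 then 1 else 0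
    have hb : (fun i => (b i : ZMod 2)) = B := by
      funext i
      simp only [b]
      push_cast
      generalize B i = x
      revert x
      decide
    have hhalf : ∀ i, 2 * ((b i : ℚ) / 2) = b i := fun i => by ring
    have hdvd := (exists_two_mul_sum_eq_iff τ _ b hhalf).mp
      (h _ ⟨b, hhalf, hb.symm ▸ hB⟩)
    rw [sum_ite_mul_ite_comp] at hdvd
    exact_mod_cast hdvd
  · rintro h α ⟨a, ha, haC⟩
    rw [exists_two_mul_sum_eq_iff τ α a ha]
    refine (dvd_iff_dvd_of_dvd_sub (four_dvd_sum_mul_comp_sub τ hτ a _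
      fun i => two_dvd_sub_ite_intCast (a i))).mpr ?_
    rw [sum_ite_mul_ite_comp τ fun i => (a i : ZMod 2)]
    exact_mod_cast h _ haC
end

section
/- For every complex number z with ‖z‖ < 1, the Jacobi theta identity ϑ₂(q)² = 2·ϑ₂(q²)·ϑ₃(q²) holds; in the variable z = q^{1/8} this reads (∑_{n ∈ ℤ} z^{(2n+1)²})² = 2 · (∑_{n ∈ ℤ} z^{2(2n+1)²}) · (∑_{n ∈ ℤ} z^{8n²}), where all series converge absolutely. -/
/-- Pairs of integers, split by the parity of `a - b`: a pair with `a - b` even is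
`(m + k, m - k)`, and one with `a - b` odd is `(m + k, k - m - 1)`. -/
def intProdParityEquiv : (ℤ × ℤ) ⊕ (ℤ × ℤ) ≃ ℤ × ℤ where
  toFun := Sum.elim (fun p => (p.1 + p.2, p.1 - p.2)) (fun p => (p.1 + p.2, p.2 - p.1 - 1))
  invFun p :=
    if (p.1 - p.2) % 2 = 0 then Sum.inl ((p.1 + p.2) / 2, (p.1 - p.2) / 2)
    else Sum.inr ((p.1 - p.2 - 1) / 2, (p.1 + p.2 + 1) / 2)
  left_inv := by
    rintro (⟨m, k⟩ | ⟨m, k⟩)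
    · have h : (m + k - (m - k)) % 2 = 0 := by omega
      simp only [Sum.elim_inl, h, if_true, Sum.inl.injEq, Prod.mk.injEq]
      omega
    · have h : ¬ (m + k - (k - m - 1)) % 2 = 0 := by omega
      simp only [Sum.elim_inr, h, if_false, Sum.inr.injEq, Prod.mk.injEq]
      omega
  right_inv := by
    rintro ⟨a, b⟩
    by_cases h : (a - b) % 2 = 0
    · simp only [h, if_true, Sum.elim_inl, Prod.mk.injEq]
      omega
    · simp only [h, if_false, Sum.elim_inr, Prod.mk.injEq]
      omega

theorem summable_norm_pow_of_natAbs_le {R : Type*} [NormedDivisionRing R] {z : R} (hz : ‖z‖ < 1)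
    {e : ℤ → ℕ} (he : ∀ n, n.natAbs ≤ e n) : Summable fun n : ℤ => ‖z ^ e n‖ := by
  have hgeom : Summable fun n : ℤ => ‖z‖ ^ n.natAbs := by
    apply Summable.of_nat_of_neg <;>
      simpa using summable_geometric_of_lt_one (norm_nonneg z) hz
  refine hgeom.of_nonneg_of_le (fun n => norm_nonneg _) fun n => ?_
  rw [norm_pow]
  exact pow_le_pow_of_le_one (norm_nonneg z) hz.le (he n)


/-- The Jacobi theta identity `ϑ₂(q)² = 2·ϑ₂(q²)·ϑ₃(q²)` ((T4) in the paper),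
written in the variable `z = q^{1/8}` so that all exponents are nonnegative
integers: `(∑_{n ∈ ℤ} z^{(2n+1)²})² = 2 (∑_{n ∈ ℤ} z^{2(2n+1)²}) (∑_{n ∈ ℤ} z^{8n²})`
for `‖z‖ < 1`, all three series converging absolutely. -/
theorem stmt_9 (z : ℂ) (hz : ‖z‖ < 1) :
    Summable (fun n : ℤ => ‖z ^ ((2 * n + 1).natAbs ^ 2)‖) ∧
    Summable (fun n : ℤ => ‖z ^ (2 * (2 * n + 1).natAbs ^ 2)‖) ∧
    Summable (fun n : ℤ => ‖z ^ (8 * n.natAbs ^ 2)‖) ∧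
    (∑' n : ℤ, z ^ ((2 * n + 1).natAbs ^ 2)) ^ 2 =
      2 * (∑' n : ℤ, z ^ (2 * (2 * n + 1).natAbs ^ 2)) *
        (∑' n : ℤ, z ^ (8 * n.natAbs ^ 2)) := by
  have h₁ := summable_norm_pow_of_natAbs_le hz (e := fun n => (2 * n + 1).natAbs ^ 2)
    fun n => le_trans (by omega) (Nat.le_self_pow two_ne_zero _)
  have h₂ := summable_norm_pow_of_natAbs_le hz (e := fun n => 2 * (2 * n + 1).natAbs ^ 2)
    fun n => le_trans (by omega : _ ≤ 2 * (2 * n + 1).natAbs)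
      (Nat.mul_le_mul_left 2 (Nat.le_self_pow two_ne_zero _))
  have h₃ := summable_norm_pow_of_natAbs_le hz (e := fun n => 8 * n.natAbs ^ 2)
    fun n => le_trans (by omega : _ ≤ 8 * n.natAbs)
      (Nat.mul_le_mul_left 8 (Nat.le_self_pow two_ne_zero _))
  refine ⟨h₁, h₂, h₃, ?_⟩
  have hprod := (summable_mul_of_summable_norm h₂ h₃).hasSum
  rw [← tsum_mul_tsum_of_summable_norm h₂ h₃] at hprod
  have hinl (p : ℤ × ℤ) :
      z ^ ((2 * (p.1 + p.2) + 1).natAbs ^ 2) * z ^ ((2 * (p.1 - p.2) + 1).natAbs ^ 2) =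
        z ^ (2 * (2 * p.1 + 1).natAbs ^ 2) * z ^ (8 * p.2.natAbs ^ 2) := by
    rw [← pow_add, ← pow_add]
    congr 1
    zify
    simp only [sq_abs]
    ring
  have hinr (p : ℤ × ℤ) :
      z ^ ((2 * (p.1 + p.2) + 1).natAbs ^ 2) * z ^ ((2 * (p.2 - p.1 - 1) + 1).natAbs ^ 2) =
        z ^ (2 * (2 * p.1 + 1).natAbs ^ 2) * z ^ (8 * p.2.natAbs ^ 2) := by
    rw [← pow_add, ← pow_add]
    congr 1
    zify
    simp only [sq_abs]
    ring
  have hsum := (intProdParityEquiv.hasSum_iff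
    (f := fun p : ℤ × ℤ => z ^ ((2 * p.1 + 1).natAbs ^ 2) * z ^ ((2 * p.2 + 1).natAbs ^ 2))).1
    (HasSum.sum (hprod.congr_fun hinl) (hprod.congr_fun hinr))
  rw [sq, tsum_mul_tsum_of_summable_norm h₁ h₁, hsum.tsum_eq]
  ring
end

section
/- Let N ≥ 2. The dual lattice of D_N, namely D_N* = {x : Fin N → ℝ | ∀ y : Fin N → ℤ with ∑ᵢ y i even, ∑ᵢ (x i)·(y i) ∈ ℤ}, equals the union {x | ∀ i, x i ∈ ℤ} ∪ {x | ∀ i, x i − 1/2 ∈ ℤ}; consequently its theta series satisfies θ_{D_N*}(q) = ϑ₃(q)^N + ϑ₂(q)^N, i.e., for every k ∈ ℝ the number of x ∈ D_N* with ∑ᵢ (x i)² = k equals (the number of n : Fin N → ℤ with ∑ᵢ (n i)² = k) plus (the number of n : Fin N → ℤ with ∑ᵢ (2·n i + 1)² = 4k). -/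
/-- A real vector pairs integrally with every integer vector of even coordinate sum iff its
coordinates are all integers or all half-odd integers. -/
theorem forall_even_sum_exists_int_iff {N : ℕ} (hN : 2 ≤ N) (x : Fin N → ℝ) :
    (∀ y : Fin N → ℤ, Even (∑ i, y i) → ∃ m : ℤ, ∑ i, x i * (y i : ℝ) = (m : ℝ)) ↔
      (∀ i, ∃ m : ℤ, x i = (m : ℝ)) ∨ ∀ i, ∃ m : ℤ, x i - 1 / 2 = (m : ℝ) := by
  constructor
  · intro h
    have add_mem (i j : Fin N) : ∃ m : ℤ, x i + x j = (m : ℝ) := by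
      obtain ⟨m, hm⟩ := h (Pi.single i 1 + Pi.single j 1)
        (by simp [Finset.sum_add_distrib, Finset.sum_pi_single'])
      refine ⟨m, ?_⟩
      rw [← hm]
      simp [mul_add, Finset.sum_add_distrib, Pi.single_apply]
    obtain ⟨m, hm⟩ := add_mem ⟨0, by omega⟩ ⟨0, by omega⟩
    obtain ⟨s, hs⟩ | ⟨s, hs⟩ := Int.even_or_odd m
    · left
      intro i
      obtain ⟨t, ht⟩ := add_mem i ⟨0, by omega⟩
      refine ⟨t - s, ?_⟩
      subst hs
      push_cast at *
      linarith
    · right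
      intro i
      obtain ⟨t, ht⟩ := add_mem i ⟨0, by omega⟩
      refine ⟨t - s - 1, ?_⟩
      subst hs
      push_cast at *
      linarith
  · rintro (h | h) y ⟨r, hr⟩
    · choose m hm using h
      exact ⟨∑ i, m i * y i, by simp [hm]⟩
    · choose m hm using h
      refine ⟨∑ i, m i * y i + r, ?_⟩
      have hx (i) : x i = m i + 1 / 2 := by linarith [hm i]
      have hr' : ∑ i, (y i : ℝ) = r + r := by exact_mod_cast hr
      simp only [hx, add_mul, Finset.sum_add_distrib, ← Finset.mul_sum, hr']
      push_cast
      ring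

theorem finite_subtype_sum_eq {ι : Type*} [Fintype ι] {f : ℤ → ℤ}
    (hf : ∀ n, |n| ≤ f n) (c : ℝ) :
    Finite {n : ι → ℤ // ((∑ i, f (n i) : ℤ) : ℝ) = c} := by
  classical
  refine ((Set.finite_Icc (fun _ : ι => -⌊c⌋) (fun _ => ⌊c⌋)).subset
    fun n (hn : ((∑ i, f (n i) : ℤ) : ℝ) = c) => ?_).to_subtype
  have hle (i) : |n i| ≤ ⌊c⌋ := by
    rw [← hn, Int.floor_intCast]
    exact (hf _).trans (Finset.single_le_sum (f := fun i => f (n i))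
      (fun j _ => (abs_nonneg _).trans (hf _)) (Finset.mem_univ i))
  exact ⟨fun i => (abs_le.mp (hle i)).1, fun i => (abs_le.mp (hle i)).2⟩

theorem sum_add_half_sq {ι : Type*} [Fintype ι] (n : ι → ℤ) (k : ℝ) :
    ∑ i, ((n i : ℝ) + 1 / 2) ^ 2 = k ↔ ((∑ i, (2 * n i + 1) ^ 2 : ℤ) : ℝ) = 4 * k := by
  have h : ((∑ i, (2 * n i + 1) ^ 2 : ℤ) : ℝ) = 4 * ∑ i, ((n i : ℝ) + 1 / 2) ^ 2 := by
    push_cast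
    rw [Finset.mul_sum]
    exact Finset.sum_congr rfl fun i _ => by ring
  rw [h]
  constructor <;> intro h <;> linarith


/-- Lemma 6.2(4) of the paper: for `N ≥ 2`, the dual lattice of `D_N` equals
`ℤ^N ∪ (ℤ + 1/2)^N`, and consequently its theta series is
`θ_{D_N*}(q) = ϑ₃(q)^N + ϑ₂(q)^N`: for every `k ∈ ℝ`, the number of `x ∈ D_N*`
with `∑ᵢ (x i)² = k` equals the number of integer vectors `n` with
`∑ᵢ (n i)² = k` plus the number of integer vectors `n` with
`∑ᵢ (2 n i + 1)² = 4k`. -/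
theorem stmt_11 (N : ℕ) (hN : 2 ≤ N) :
    ({x : Fin N → ℝ | ∀ y : Fin N → ℤ, Even (∑ i, y i) →
        ∃ m : ℤ, ∑ i, x i * (y i : ℝ) = (m : ℝ)}
      = {x : Fin N → ℝ | ∀ i, ∃ m : ℤ, x i = (m : ℝ)}
        ∪ {x : Fin N → ℝ | ∀ i, ∃ m : ℤ, x i - 1 / 2 = (m : ℝ)}) ∧
    ∀ k : ℝ,
      Nat.card {x : Fin N → ℝ //
          (∀ y : Fin N → ℤ, Even (∑ i, y i) →
            ∃ m : ℤ, ∑ i, x i * (y i : ℝ) = (m : ℝ)) ∧ ∑ i, x i ^ 2 = k}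
        = Nat.card {n : Fin N → ℤ // ((∑ i, (n i) ^ 2 : ℤ) : ℝ) = k}
          + Nat.card {n : Fin N → ℤ //
              ((∑ i, (2 * n i + 1) ^ 2 : ℤ) : ℝ) = 4 * k} := by
  refine ⟨Set.ext (forall_even_sum_exists_int_iff hN), fun k => ?_⟩
  have := finite_subtype_sum_eq (ι := Fin N) (f := fun n => n ^ 2)
    (fun n => by rw [← sq_abs]; nlinarith [Int.le_self_sq |n|]) k
  have := finite_subtype_sum_eq (ι := Fin N) (f := fun n => (2 * n + 1) ^ 2)
    (fun n => abs_le.mpr ⟨by nlinarith, by nlinarith⟩) (4 * k)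
  rw [← Nat.card_sum]
  symm
  refine Nat.card_congr (Equiv.ofBijective (Sum.elim
    (fun n => ⟨fun i => n.1 i, (forall_even_sum_exists_int_iff hN _).2 (.inl fun i => ⟨_, rfl⟩),
      by simpa using n.2⟩)
    (fun n => ⟨fun i => n.1 i + 1 / 2, (forall_even_sum_exists_int_iff hN _).2
      (.inr fun i => ⟨n.1 i, by ring⟩), (sum_add_half_sq _ _).2 n.2⟩)) ⟨?_, ?_⟩)
  · refine Function.Injective.sumElim ?_ ?_ ?_
    · intro a b hab
      ext i
      simpa using congrFun (congrArg Subtype.val hab) i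
    · intro a b hab
      ext i
      simpa using congrFun (congrArg Subtype.val hab) i
    · intro a b hab
      have h : (a.1 ⟨0, by omega⟩ : ℝ) = b.1 ⟨0, by omega⟩ + 1 / 2 :=
        congrFun (congrArg Subtype.val hab) ⟨0, by omega⟩
      have h' : 2 * a.1 ⟨0, by omega⟩ = 2 * b.1 ⟨0, by omega⟩ + 1 := by
        have : (2 * a.1 ⟨0, by omega⟩ : ℝ) = 2 * b.1 ⟨0, by omega⟩ + 1 := by linarith
        exact_mod_cast this
      omega
  · rintro ⟨x, hx, hk⟩
    obtain h | h := (forall_even_sum_exists_int_iff hN x).1 hx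
    · choose m hm using h
      obtain rfl : x = fun i => (m i : ℝ) := funext hm
      exact ⟨.inl ⟨m, by simpa using hk⟩, rfl⟩
    · choose m hm using h
      obtain rfl : x = fun i => (m i : ℝ) + 1 / 2 := funext fun i => by linarith [hm i]
      exact ⟨.inr ⟨m, (sum_add_half_sq _ _).1 hk⟩, rfl⟩
end

section
/- For every complex number q with ‖q‖ < 1, the identity η(q)²/η(q²) = ϑ₄(q²) holds; equivalently, after cancelling the fractional powers of q, ∑_{n ∈ ℤ} (−1)^n q^{n²} = ∏_{n ≥ 1} (1 − q^n)² / (1 − q^{2n}), where the sum converges absolutely and the infinite product converges. -/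
open Filter Topology Finset

/-- The `q`-Pochhammer symbol `(x; x)_n = ∏_{i = 1}^n (1 - x ^ i)`. -/
def qPochhammer (x : ℂ) (n : ℕ) : ℂ := ∏ i ∈ range n, (1 - x ^ (i + 1))

/-- The Gaussian binomial coefficient in base `x`, as a quotient of `q`-Pochhammer symbols. -/
noncomputable def gaussBinom (x : ℂ) (n k : ℕ) : ℂ :=
  if k ≤ n then qPochhammer x n / (qPochhammer x k * qPochhammer x (n - k)) else 0

/-- The general term `(-1) ^ j * q ^ (j ^ 2)` of the theta series. -/
noncomputable def thetaTerm (q : ℂ) (j : ℤ) : ℂ := (-1) ^ j * q ^ (j.natAbs ^ 2)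

lemma one_sub_pow_succ_ne_zero {x : ℂ} (hx : ‖x‖ < 1) (n : ℕ) : 1 - x ^ (n + 1) ≠ 0 := by
  intro h
  have h1 : ‖x ^ (n + 1)‖ < 1 := by
    rw [norm_pow]
    exact pow_lt_one₀ (norm_nonneg _) hx n.succ_ne_zero
  rw [← sub_eq_zero.mp h] at h1
  simp at h1

lemma qPochhammer_succ (x : ℂ) (n : ℕ) :
    qPochhammer x (n + 1) = qPochhammer x n * (1 - x ^ (n + 1)) := prod_range_succ _ _

lemma qPochhammer_ne_zero {x : ℂ} (hx : ‖x‖ < 1) (n : ℕ) : qPochhammer x n ≠ 0 :=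
  prod_ne_zero_iff.mpr fun i _ ↦ one_sub_pow_succ_ne_zero hx i

lemma gaussBinom_zero_right {x : ℂ} (hx : ‖x‖ < 1) (n : ℕ) : gaussBinom x n 0 = 1 := by
  have h0 : qPochhammer x 0 = 1 := rfl
  rw [gaussBinom, if_pos n.zero_le, h0, one_mul, Nat.sub_zero,
    div_self (qPochhammer_ne_zero hx n)]

lemma gaussBinom_of_lt (x : ℂ) {n k : ℕ} (h : n < k) : gaussBinom x n k = 0 :=
  if_neg h.not_ge

lemma gaussBinom_symm (x : ℂ) {n k : ℕ} (h : k ≤ n) :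
    gaussBinom x n (n - k) = gaussBinom x n k := by
  rw [gaussBinom, gaussBinom, if_pos (Nat.sub_le _ _), if_pos h, Nat.sub_sub_self h, mul_comm]

lemma gaussBinom_succ_succ {x : ℂ} (hx : ‖x‖ < 1) {n k : ℕ} (h : k ≤ n) :
    gaussBinom x (n + 1) (k + 1) = gaussBinom x n k + x ^ (k + 1) * gaussBinom x n (k + 1) := by
  obtain ⟨d, rfl⟩ := Nat.exists_eq_add_of_le h
  have hk := qPochhammer_ne_zero hx k
  have hk' := one_sub_pow_succ_ne_zero hx k
  have hn := qPochhammer_ne_zero hx (k + d)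
  cases d with
  | zero =>
    have h0 : qPochhammer x 0 = 1 := rfl
    rw [gaussBinom_of_lt x (show k + 0 < k + 1 by omega)]
    simp only [gaussBinom, add_zero, le_refl, if_true, Nat.sub_self, h0, mul_one, mul_zero]
    rw [div_self (qPochhammer_ne_zero hx _), div_self hk]
  | succ d =>
    have hd := qPochhammer_ne_zero hx d
    have hd' := one_sub_pow_succ_ne_zero hx d
    rw [gaussBinom, gaussBinom, gaussBinom, if_pos (by omega), if_pos (by omega),
      if_pos (by omega), show k + (d + 1) + 1 - (k + 1) = d + 1 by omega,
      show k + (d + 1) - k = d + 1 by omega, show k + (d + 1) - (k + 1) = d by omega,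
      qPochhammer_succ x (k + (d + 1)), qPochhammer_succ x k, qPochhammer_succ x d]
    field_simp
    ring

lemma thetaTerm_neg (q : ℂ) (j : ℤ) : thetaTerm q (-j) = thetaTerm q j := by
  simp [thetaTerm, zpow_neg, ← inv_zpow, inv_neg]

lemma pow_mul_thetaTerm (q : ℂ) (k n : ℕ) :
    (q ^ 2) ^ k * thetaTerm q (k - (n + 1 : ℕ)) =
      -q ^ (2 * n + 1) * thetaTerm q (k - n) := by
  have hexp : 2 * k + ((k : ℤ) - (n + 1 : ℕ)).natAbs ^ 2 =
      2 * n + 1 + ((k : ℤ) - n).natAbs ^ 2 := by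
    zify
    simp only [sq_abs]
    ring
  have hsign : (-1 : ℂ) ^ ((k : ℤ) - n) = -(-1) ^ ((k : ℤ) - (n + 1 : ℕ)) := by
    rw [show (k : ℤ) - n = (k - (n + 1 : ℕ)) + 1 by push_cast; ring,
      zpow_add_one₀ (by norm_num)]
    ring
  have hq := congrArg (q ^ ·) hexp
  simp only [pow_add, pow_mul] at hq
  rw [thetaTerm, thetaTerm, hsign, pow_add, pow_mul]
  linear_combination (-1 : ℂ) ^ ((k : ℤ) - (n + 1 : ℕ)) * hq

/-- The weighted theta sum in the finite form of the Jacobi triple product at `z = -1`. -/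
noncomputable def finiteTheta (q : ℂ) (m n : ℕ) : ℂ :=
  ∑ k ∈ range (m + n + 1), gaussBinom (q ^ 2) (m + n) k * thetaTerm q (k - n)

lemma finiteTheta_symm (q : ℂ) (m n : ℕ) : finiteTheta q m n = finiteTheta q n m := by
  rw [finiteTheta, finiteTheta, ← sum_range_reflect, add_comm n m]
  refine sum_congr rfl fun k hk ↦ ?_
  have hk' : k ≤ m + n := by simpa [Nat.lt_succ_iff] using hk
  rw [show m + n + 1 - 1 - k = m + n - k by omega, gaussBinom_symm _ hk', ← thetaTerm_neg]
  congr 2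
  push_cast [hk']
  ring

lemma finiteTheta_succ_right {q : ℂ} (hq : ‖q ^ 2‖ < 1) (m n : ℕ) :
    finiteTheta q m (n + 1) = (1 - q ^ (2 * n + 1)) * finiteTheta q m n := by
  have hshift : ∑ k ∈ range (m + n + 1 + 1), gaussBinom (q ^ 2) (m + n) k * thetaTerm q (k - n) =
      finiteTheta q m n := by
    rw [sum_range_succ, gaussBinom_of_lt _ (Nat.lt_succ_self _), zero_mul, add_zero, finiteTheta]
  have hpascal : ∀ k ∈ range (m + n + 1),
      gaussBinom (q ^ 2) (m + n + 1) (k + 1) * thetaTerm q ((k + 1 : ℕ) - (n + 1 : ℕ)) =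
        gaussBinom (q ^ 2) (m + n) k * thetaTerm q (k - n) + -q ^ (2 * n + 1) *
          (gaussBinom (q ^ 2) (m + n) (k + 1) * thetaTerm q ((k + 1 : ℕ) - n)) := by
    intro k hk
    have ht := pow_mul_thetaTerm q (k + 1) n
    have hkn : thetaTerm q ((k + 1 : ℕ) - (n + 1 : ℕ)) = thetaTerm q (k - n) := by
      congr 1
      push_cast
      ring
    rw [gaussBinom_succ_succ hq (Nat.lt_succ_iff.mp (mem_range.mp hk)), add_mul]
    nth_rw 1 [hkn]
    linear_combination gaussBinom (q ^ 2) (m + n) (k + 1) * ht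
  have hzero := pow_mul_thetaTerm q 0 n
  rw [finiteTheta, ← add_assoc, sum_range_succ', sum_congr rfl hpascal, sum_add_distrib,
    ← mul_sum, gaussBinom_zero_right hq]
  rw [sum_range_succ', gaussBinom_zero_right hq] at hshift
  rw [← finiteTheta]
  linear_combination hzero - q ^ (2 * n + 1) * hshift

lemma finiteTheta_eq_mul {q : ℂ} (hq : ‖q ^ 2‖ < 1) (m n : ℕ) :
    finiteTheta q m n = (∏ i ∈ range n, (1 - q ^ (2 * i + 1))) * finiteTheta q m 0 := by
  induction n with
  | zero => simp
  | succ n ih => rw [finiteTheta_succ_right hq, ih, prod_range_succ]; ring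

/-- The finite Jacobi triple product at `z = -1`. -/
lemma finiteTheta_eq_prod {q : ℂ} (hq : ‖q ^ 2‖ < 1) (m n : ℕ) :
    finiteTheta q m n =
      (∏ i ∈ range m, (1 - q ^ (2 * i + 1))) * ∏ i ∈ range n, (1 - q ^ (2 * i + 1)) := by
  have h0 : finiteTheta q 0 0 = 1 := by
    simp [finiteTheta, thetaTerm, gaussBinom_zero_right hq]
  rw [finiteTheta_eq_mul hq, finiteTheta_symm, finiteTheta_eq_mul hq, h0]
  ring

lemma qPochhammer_two_mul (q : ℂ) (n : ℕ) :
    qPochhammer q (2 * n) =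
      (∏ i ∈ range n, (1 - q ^ (2 * i + 1))) * qPochhammer (q ^ 2) n := by
  induction n with
  | zero => simp [qPochhammer]
  | succ n ih =>
    rw [mul_add_one, qPochhammer_succ, qPochhammer_succ, ih, prod_range_succ, qPochhammer_succ]
    ring

lemma tendsto_qPochhammer {x : ℂ} (hx : ‖x‖ < 1) :
    Tendsto (qPochhammer x) atTop (𝓝 (∏' n : ℕ, (1 - x ^ (n + 1)))) :=
  (ModularForm.multipliable_one_sub_pow hx).hasProd.tendsto_prod_nat

lemma tprod_one_sub_pow_ne_zero {x : ℂ} (hx : ‖x‖ < 1) : ∏' n : ℕ, (1 - x ^ (n + 1)) ≠ 0 := by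
  refine tprod_one_add_ne_zero_of_summable (f := fun n : ℕ ↦ -x ^ (n + 1)) ?_ ?_
  · simpa [← sub_eq_add_neg] using one_sub_pow_succ_ne_zero hx
  · simpa using (summable_nat_add_iff 1).mpr (summable_geometric_of_lt_one (norm_nonneg _) hx)

lemma exists_norm_gaussBinom_le {x : ℂ} (hx : ‖x‖ < 1) :
    ∃ C, ∀ n k, ‖gaussBinom x n k‖ ≤ C := by
  have hP := tendsto_qPochhammer hx
  obtain ⟨A, hA⟩ := (Metric.isBounded_range_of_tendsto _ hP).exists_norm_le
  obtain ⟨B, hB⟩ := (Metric.isBounded_range_of_tendsto _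
    (hP.inv₀ (tprod_one_sub_pow_ne_zero hx))).exists_norm_le
  have hA' n : ‖qPochhammer x n‖ ≤ A := hA _ ⟨n, rfl⟩
  have hB' n : ‖(qPochhammer x n)⁻¹‖ ≤ B := hB _ ⟨n, rfl⟩
  have hA0 : 0 ≤ A := (norm_nonneg _).trans (hA' 0)
  have hB0 : 0 ≤ B := (norm_nonneg _).trans (hB' 0)
  refine ⟨A * (B * B), fun n k ↦ ?_⟩
  rw [gaussBinom]
  split_ifs
  · rw [div_eq_mul_inv, mul_inv, norm_mul, norm_mul]
    gcongr
    exacts [hA' _, hB' _, hB' _]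
  · rw [norm_zero]
    positivity

lemma tendsto_gaussBinom_central {x : ℂ} (hx : ‖x‖ < 1) (j : ℤ) :
    Tendsto (fun n : ℕ ↦ gaussBinom x (n + n) (n + j).toNat) atTop
      (𝓝 (∏' n : ℕ, (1 - x ^ (n + 1)))⁻¹) := by
  have hP := tendsto_qPochhammer hx
  have hL := tprod_one_sub_pow_ne_zero hx
  have h1 : Tendsto (fun n : ℕ ↦ n + n) atTop atTop :=
    tendsto_atTop_mono (fun n ↦ Nat.le_add_left n n) tendsto_id
  have h2 (i : ℤ) : Tendsto (fun n : ℕ ↦ ((n : ℤ) + i).toNat) atTop atTop :=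
    tendsto_atTop.mpr fun b ↦ by
      filter_upwards [eventually_ge_atTop (b + i.natAbs)] with n hn
      omega
  have := (hP.comp h1).div ((hP.comp (h2 j)).mul (hP.comp (h2 (-j)))) (mul_ne_zero hL hL)
  rw [div_mul_cancel_left₀ hL] at this
  refine this.congr' ?_
  filter_upwards [eventually_ge_atTop j.natAbs] with n hn
  rw [gaussBinom, if_pos (by omega)]
  simp only [Function.comp_apply, Pi.div_apply]
  congr 3
  omega

lemma summable_norm_thetaTerm {q : ℂ} (hq : ‖q‖ < 1) : Summable fun j ↦ ‖thetaTerm q j‖ := by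
  have hnat : Summable fun n : ℕ ↦ ‖thetaTerm q n‖ := by
    refine (summable_geometric_of_lt_one (norm_nonneg q) hq).of_nonneg_of_le
      (fun _ ↦ norm_nonneg _) fun n ↦ ?_
    simp only [thetaTerm, norm_mul, norm_zpow, norm_neg, norm_one, one_zpow, one_mul, norm_pow,
      Int.natAbs_natCast]
    exact pow_le_pow_of_le_one (norm_nonneg _) hq.le (Nat.le_self_pow two_ne_zero n)
  exact hnat.of_nat_of_neg (by simpa only [thetaTerm_neg] using hnat)

lemma finiteTheta_self_eq_tsum (q : ℂ) (n : ℕ) :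
    finiteTheta q n n = ∑' j : ℤ, (if j ∈ Icc (-n : ℤ) n then
      gaussBinom (q ^ 2) (n + n) (n + j).toNat * thetaTerm q j else 0) := by
  rw [tsum_eq_sum (s := Icc (-n : ℤ) n) fun j hj ↦ if_neg hj, finiteTheta,
    sum_congr rfl fun j hj ↦ if_pos hj]
  refine sum_nbij' (fun k ↦ (k : ℤ) - n) (fun j ↦ (n + j).toNat) ?_ ?_ ?_ ?_ ?_
  · intro k hk
    simp only [mem_range, mem_Icc] at hk ⊢
    omega
  · intro j hj
    simp only [mem_range, mem_Icc] at hj ⊢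
    omega
  · intro k _
    simp
  · intro j hj
    simp only [mem_Icc] at hj
    omega
  · intro k _
    simp

/-- Gauss's evaluation of the theta series `∑ (-1) ^ j * q ^ (j ^ 2)`. -/
lemma tsum_thetaTerm {q : ℂ} (hq : ‖q‖ < 1) :
    ∑' j, thetaTerm q j =
      (∏' n : ℕ, (1 - q ^ (n + 1))) ^ 2 / ∏' n : ℕ, (1 - (q ^ 2) ^ (n + 1)) := by
  have hq2 : ‖q ^ 2‖ < 1 := by
    rw [norm_pow]
    exact pow_lt_one₀ (norm_nonneg _) hq two_ne_zero
  have hL := tprod_one_sub_pow_ne_zero hq2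
  obtain ⟨C, hC⟩ := exists_norm_gaussBinom_le hq2
  have hC0 : 0 ≤ C := (norm_nonneg _).trans (hC 0 0)
  have hsum : Tendsto (fun n ↦ finiteTheta q n n) atTop
      (𝓝 (∑' j, (∏' n : ℕ, (1 - (q ^ 2) ^ (n + 1)))⁻¹ * thetaTerm q j)) := by
    simp only [finiteTheta_self_eq_tsum]
    refine tendsto_tsum_of_dominated_convergence ((summable_norm_thetaTerm hq).mul_left C)
      (fun j ↦ ?_) (.of_forall fun n j ↦ ?_)
    · refine ((tendsto_gaussBinom_central hq2 j).mul_const _).congr' ?_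
      filter_upwards [eventually_ge_atTop j.natAbs] with n hn
      rw [if_pos (by rw [mem_Icc]; omega)]
    · split_ifs
      · rw [norm_mul]
        gcongr
        exact hC _ _
      · rw [norm_zero]
        positivity
  have hodd : Tendsto (fun n ↦ ∏ i ∈ range n, (1 - q ^ (2 * i + 1))) atTop
      (𝓝 ((∏' n : ℕ, (1 - q ^ (n + 1))) / ∏' n : ℕ, (1 - (q ^ 2) ^ (n + 1)))) := by
    have h2 : Tendsto (fun n : ℕ ↦ 2 * n) atTop atTop :=
      tendsto_id.const_mul_atTop' two_pos
    refine (((tendsto_qPochhammer hq).comp h2).div (tendsto_qPochhammer hq2) hL).congr fun n ↦ ?_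
    simp only [Function.comp_apply, Pi.div_apply]
    rw [qPochhammer_two_mul, mul_div_cancel_right₀ _ (qPochhammer_ne_zero hq2 n)]
  have huniq := tendsto_nhds_unique hsum
    ((hodd.mul hodd).congr fun n ↦ (finiteTheta_eq_prod hq2 n n).symm)
  rw [tsum_mul_left] at huniq
  field_simp at huniq ⊢
  exact huniq

/-- Lemma 6.2(5) of the paper, `η(q)²/η(q²) = ϑ₄(q²)`, in its prefactor-free
form: for `‖q‖ < 1`,
`∑_{n ∈ ℤ} (−1)ⁿ q^{n²} = ∏_{n ≥ 1} (1 − qⁿ)² / (1 − q^{2n})`,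
where the sum converges absolutely and the infinite product converges. -/
theorem stmt_12 (q : ℂ) (hq : ‖q‖ < 1) :
    Summable (fun n : ℤ => ‖(-1 : ℂ) ^ n * q ^ (n.natAbs ^ 2)‖) ∧
    Multipliable (fun n : ℕ => (1 - q ^ (n + 1)) ^ 2 / (1 - q ^ (2 * (n + 1)))) ∧
    (∑' n : ℤ, (-1 : ℂ) ^ n * q ^ (n.natAbs ^ 2)) =
      ∏' n : ℕ, (1 - q ^ (n + 1)) ^ 2 / (1 - q ^ (2 * (n + 1))) := by
  have hq2 : ‖q ^ 2‖ < 1 := by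
    rw [norm_pow]
    exact pow_lt_one₀ (norm_nonneg _) hq two_ne_zero
  have hprod := ((ModularForm.multipliable_one_sub_pow hq).hasProd.pow 2).div₀
    (ModularForm.multipliable_one_sub_pow hq2).hasProd (tprod_one_sub_pow_ne_zero hq2)
  simp only [pow_mul]
  exact ⟨summable_norm_thetaTerm hq, hprod.multipliable,
    (tsum_thetaTerm hq).trans hprod.tprod_eq.symm⟩
end

section
/- Let p < q be primes and let H be a nonabelian finite group of order p²·q whose Sylow q-subgroup is not normal (equivalently, the number n_q of Sylow q-subgroups is greater than 1). Then n_q = p², the Sylow p-subgroup P of H is unique and normal, and for every class function f : H → ℂ and every Sylow q-subgroup Q of H, the averaging identity ∑_{h ∈ H} f(h) = ∑_{h ∈ P} f(h) + p²·∑_{h ∈ Q} f(h) − p²·f(1) holds. (Applied to graded traces on a lattice vertex operator algebra V_L, this yields the paper's relation q·Ch V^{ℤ_{p²} ⋊ ℤ_q} = Ch V^{ℤ_{p²}} + q·Ch V^{ℤ_q} − Ch V_L.) -/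
section SylowUnion

variable {H : Type*} [Group H] [Fintype H] {p q : ℕ}

theorem Sylow.card_eq_sq_of_card_eq_sq_mul [Fact p.Prime] (hq : q.Prime) (hpq : p < q)
    (hcard : Fintype.card H = p ^ 2 * q) (P : Sylow p H) : Nat.card P = p ^ 2 := by
  have hp : p.Prime := Fact.out
  rw [P.card_eq_multiplicity, Nat.card_eq_fintype_card, hcard,
    Nat.factorization_mul (pow_ne_zero 2 hp.ne_zero) hq.ne_zero]
  simp [hp.factorization, hq.factorization, hpq.ne']

theorem Sylow.card_eq_of_card_eq_sq_mul [Fact q.Prime] (hp : p.Prime) (hpq : p < q)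
    (hcard : Fintype.card H = p ^ 2 * q) (Q : Sylow q H) : Nat.card Q = q := by
  have hq : q.Prime := Fact.out
  rw [Q.card_eq_multiplicity, Nat.card_eq_fintype_card, hcard,
    Nat.factorization_mul (pow_ne_zero 2 hp.ne_zero) hq.ne_zero]
  simp [hp.factorization, hq.factorization, hpq.ne]

theorem card_sylow_eq_sq_of_card_eq_sq_mul [Fact q.Prime] (hp : p.Prime) (hpq : p < q)
    (hcard : Fintype.card H = p ^ 2 * q) (hnq : 1 < Nat.card (Sylow q H)) :
    Nat.card (Sylow q H) = p ^ 2 := by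
  have hq : q.Prime := Fact.out
  obtain ⟨Q⟩ : Nonempty (Sylow q H) := inferInstance
  have hindex : (Q : Subgroup H).index = p ^ 2 := by
    have h := (Q : Subgroup H).card_mul_index
    rw [Q.card_eq_of_card_eq_sq_mul hp hpq hcard, Nat.card_eq_fintype_card, hcard,
      mul_comm (p ^ 2)] at h
    exact Nat.eq_of_mul_eq_mul_left hq.pos h
  obtain ⟨k, hk, hnk⟩ := (Nat.dvd_prime_pow hp).1 (hindex ▸ Q.card_dvd_index)
  have hmod := card_sylow_modEq_one q H
  interval_cases k
  · exact absurd hnk (by simpa using hnq.ne')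
  · rw [hnk, pow_one, Nat.ModEq, Nat.mod_eq_of_lt hpq, Nat.mod_eq_of_lt hq.one_lt] at hmod
    exact absurd hmod hp.ne_one
  · exact hnk

theorem Subgroup.eq_of_mem_of_card_eq_prime (hq : q.Prime) {A B : Subgroup H}
    (hA : Nat.card A = q) (hB : Nat.card B = q) {x : H} (hx : x ≠ 1) (hxA : x ∈ A)
    (hxB : x ∈ B) : A = B := by
  have hzpowers {C : Subgroup H} (hC : Nat.card C = q) (hxC : x ∈ C) :
      Subgroup.zpowers x = C := by
    have hle : Subgroup.zpowers x ≤ C := by simpa using hxC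
    refine Subgroup.eq_of_le_of_card_ge hle ?_
    rcases (Nat.dvd_prime hq).1 (hC ▸ Subgroup.card_dvd_of_le hle) with h | h
    · rw [Nat.card_zpowers, orderOf_eq_one_iff] at h
      exact absurd h hx
    · rw [h, hC]
  rw [← hzpowers hA hxA, hzpowers hB hxB]

open Classical in
/-- The nontrivial elements of a subgroup, as a finset. -/
noncomputable def Subgroup.nontrivialElements (A : Subgroup H) : Finset H :=
  (A : Set H).toFinset.erase 1

theorem Subgroup.mem_nontrivialElements {A : Subgroup H} {x : H} :
    x ∈ A.nontrivialElements ↔ x ≠ 1 ∧ x ∈ A := by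
  simp [Subgroup.nontrivialElements]

theorem Subgroup.card_nontrivialElements (A : Subgroup H) :
    A.nontrivialElements.card = Nat.card A - 1 := by
  classical
  rw [Subgroup.nontrivialElements, Finset.card_erase_of_mem (by simp [A.one_mem]),
    Set.toFinset_card, ← Nat.card_eq_fintype_card]
  rfl

theorem Subgroup.sum_nontrivialElements (A : Subgroup H) (f : H → ℂ) :
    ∑ x ∈ A.nontrivialElements, f x = (∑ᶠ x ∈ A, f x) - f 1 := by
  classical
  have h : ∑ᶠ x ∈ A, f x = ∑ x ∈ (A : Set H).toFinset, f x :=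
    finsum_mem_eq_toFinset_sum f (A : Set H)
  rw [h, Subgroup.nontrivialElements, Finset.sum_erase_eq_sub (by simp [A.one_mem])]

theorem Sylow.sum_nontrivialElements_eq [Fact q.Prime] {f : H → ℂ}
    (hf : ∀ a b : H, f (a * b * a⁻¹) = f b) (Q R : Sylow q H) :
    ∑ x ∈ (R : Subgroup H).nontrivialElements, f x =
      ∑ x ∈ (Q : Subgroup H).nontrivialElements, f x := by
  obtain ⟨g, rfl⟩ := MulAction.exists_smul_eq H Q R
  refine (Finset.sum_equiv (MulAut.conj g).toEquiv (fun x => ?_) fun x _ => ?_).symm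
  · simp only [Subgroup.mem_nontrivialElements, Sylow.coe_subgroup_smul]
    refine and_congr (by simp) ?_
    exact (Subgroup.smul_mem_pointwise_smul_iff (a := MulAut.conj g) (S := (Q : Subgroup H))).symm
  · exact (hf g x).symm

theorem Sylow.pairwiseDisjoint_nontrivialElements (hq : q.Prime)
    (hQ : ∀ Q : Sylow q H, Nat.card Q = q) (s : Set (Sylow q H)) :
    s.PairwiseDisjoint fun Q : Sylow q H => (Q : Subgroup H).nontrivialElements := by
  intro Q _ R _ hQR
  refine Finset.disjoint_left.2 fun x hxQ hxR => hQR (Sylow.ext ?_)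
  rw [Subgroup.mem_nontrivialElements] at hxQ hxR
  exact Subgroup.eq_of_mem_of_card_eq_prime hq (hQ Q) (hQ R) hxQ.1 hxQ.2 hxR.2

open Classical in
/-- The nonidentity elements of `H` lying in some Sylow `q`-subgroup. -/
noncomputable def sylowNontrivialElements (q : ℕ) (H : Type*) [Group H] [Fintype H]
    [Fintype (Sylow q H)] : Finset H :=
  Finset.univ.biUnion fun Q : Sylow q H => (Q : Subgroup H).nontrivialElements

open Classical in
theorem Sylow.compl_sylowNontrivialElements [Fact p.Prime] [Fact q.Prime] [Fintype (Sylow q H)]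
    (hpq : p < q) (hcard : Fintype.card H = p ^ 2 * q)
    (hnq : 1 < Nat.card (Sylow q H)) (P : Sylow p H) :
    (sylowNontrivialElements q H)ᶜ = ((P : Subgroup H) : Set H).toFinset := by
  have hp : p.Prime := Fact.out
  have hq : q.Prime := Fact.out
  have hQ := fun Q : Sylow q H => Q.card_eq_of_card_eq_sq_mul hp hpq hcard
  have hcardU : (sylowNontrivialElements q H).card = p ^ 2 * (q - 1) := by
    rw [sylowNontrivialElements,
      Finset.card_biUnion (by simpa using Sylow.pairwiseDisjoint_nontrivialElements hq hQ Set.univ)]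
    simp only [Subgroup.card_nontrivialElements, hQ, Finset.sum_const, Finset.card_univ,
      smul_eq_mul, ← Nat.card_eq_fintype_card,
      card_sylow_eq_sq_of_card_eq_sq_mul hp hpq hcard hnq]
  have hcardP : ((P : Subgroup H) : Set H).toFinset.card = p ^ 2 := by
    rw [Set.toFinset_card, ← Nat.card_eq_fintype_card]
    exact P.card_eq_sq_of_card_eq_sq_mul hq hpq hcard
  refine (Finset.eq_of_subset_of_card_le (fun x hxP => ?_) ?_).symm
  · simp only [sylowNontrivialElements, Finset.mem_compl, Finset.mem_biUnion, Finset.mem_univ,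
      true_and, Subgroup.mem_nontrivialElements]
    rintro ⟨Q, hx, hxQ⟩
    have hdisj := IsPGroup.disjoint_of_ne p q hpq.ne _ _ P.isPGroup' Q.isPGroup'
    exact hx (Subgroup.disjoint_def.1 hdisj (Set.mem_toFinset.1 hxP) hxQ)
  · rw [Finset.card_compl, hcardU, hcardP, hcard, ← Nat.mul_sub, Nat.sub_sub_self hq.one_le, mul_one]

theorem sum_sylowNontrivialElements [Fact q.Prime] [Fintype (Sylow q H)]
    (hQ : ∀ Q : Sylow q H, Nat.card Q = q) {f : H → ℂ}
    (hf : ∀ a b : H, f (a * b * a⁻¹) = f b) (Q : Sylow q H) :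
    ∑ h ∈ sylowNontrivialElements q H, f h =
      Nat.card (Sylow q H) * ((∑ᶠ h ∈ (Q : Subgroup H), f h) - f 1) := by
  classical
  rw [sylowNontrivialElements, Finset.sum_biUnion
      (by simpa using Sylow.pairwiseDisjoint_nontrivialElements Fact.out hQ Set.univ),
    Finset.sum_congr rfl fun R _ => Sylow.sum_nontrivialElements_eq hf Q R,
    Finset.sum_const, nsmul_eq_mul, Subgroup.sum_nontrivialElements, Finset.card_univ,
    Nat.card_eq_fintype_card]

end SylowUnion


/-- Theorem 7.6 of the paper (group-theoretic core, case of non-normal Sylow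
`q`-subgroup): let `p < q` be primes and `H` a nonabelian group of order
`p²·q` with more than one Sylow `q`-subgroup.  Then the number of Sylow
`q`-subgroups is `p²`, the Sylow `p`-subgroup `P` is unique and normal, and
for every class function `f : H → ℂ` and every Sylow `q`-subgroup `Q`,
`∑_{h ∈ H} f(h) = ∑_{h ∈ P} f(h) + p²·∑_{h ∈ Q} f(h) − p²·f(1)`.  Applied to
graded traces on a lattice VOA `V_L` this yields
`q·Ch V^{ℤ_{p²} ⋊ ℤ_q} = Ch V^{ℤ_{p²}} + q·Ch V^{ℤ_q} − Ch V_L`. -/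
theorem stmt_17 (p q : ℕ) (hp : p.Prime) (hq : q.Prime) (hpq : p < q)
    (H : Type*) [Group H] [Fintype H]
    (hcard : Fintype.card H = p ^ 2 * q)
    (hnonab : ∃ a b : H, a * b ≠ b * a)
    (hnq : 1 < Nat.card (Sylow q H))
    (P : Sylow p H) :
    Nat.card (Sylow q H) = p ^ 2 ∧
    Nat.card (Sylow p H) = 1 ∧
    (P : Subgroup H).Normal ∧
    (∀ f : H → ℂ, (∀ a b : H, f (a * b * a⁻¹) = f b) →
      ∀ Q : Sylow q H,
        ∑ h : H, f h
          = (∑ᶠ h ∈ (P : Subgroup H), f h)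
            + (p : ℂ) ^ 2 * ∑ᶠ h ∈ (Q : Subgroup H), f h
            - (p : ℂ) ^ 2 * f 1) := by
  classical
  have : Fact p.Prime := ⟨hp⟩
  have : Fact q.Prime := ⟨hq⟩
  have := Fintype.ofFinite (Sylow q H)
  have hn := card_sylow_eq_sq_of_card_eq_sq_mul hp hpq hcard hnq
  have hcompl := Sylow.compl_sylowNontrivialElements hpq hcard hnq (p := p)
  have : Subsingleton (Sylow p H) := ⟨fun R S => Sylow.ext <| SetLike.coe_injective <|
    Set.toFinset_inj.1 <| (hcompl R).symm.trans (hcompl S)⟩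
  refine ⟨hn, Nat.card_eq_one_iff_unique.2 ⟨this, ⟨P⟩⟩, P.normal_of_subsingleton,
    fun f hf Q => ?_⟩
  have hsumP : ∑ᶠ h ∈ (P : Subgroup H), f h = ∑ h ∈ ((P : Subgroup H) : Set H).toFinset, f h :=
    finsum_mem_eq_toFinset_sum f ((P : Subgroup H) : Set H)
  rw [← Finset.sum_compl_add_sum (sylowNontrivialElements q H), hcompl P, ← hsumP,
    sum_sylowNontrivialElements (fun R => R.card_eq_of_card_eq_sq_mul hp hpq hcard) hf Q, hn]
  push_cast
  ring
end
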